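/- arXiv:1705.06068 — 6 statements merged into one kernel-verified Lean document; each statement's English description precedes it below -/
import Mathlib

section
/- There exists a constant c with c ≥ 10^(-10^10) such that every path-pairable planar simple graph G on n vertices has maximum degree Δ(G) ≥ c·n. -/
open SimpleGraph

/-- A simple graph `G` on `n` vertices (`n` even) is *path-pairable* if for every partition of
its vertex set into `n/2` unordered pairs (encoded as a fixed-point-free involution `f`), there
exist pairwise edge-disjoint paths joining the two vertices of each pair. -/
def IsPathPairable {V : Type*} [Fintype V] (G : SimpleGraph V) : Prop :=
  Even (Fintype.card V) ∧
    ∀ f : V → V, Function.Involutive f → (∀ v, f v ≠ v) →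
      ∃ P : (v : V) → G.Walk v (f v),
        (∀ v, (P v).IsPath) ∧
          ∀ u v : V, u ≠ v → u ≠ f v → List.Disjoint (P u).edges (P v).edges

/-- `H` is a minor of `G`: there are pairwise disjoint nonempty branch sets, each inducing a
connected subgraph of `G`, with an edge of `G` between the branch sets of any two adjacent
vertices of `H`. -/
def HasMinor {V W : Type*} (G : SimpleGraph V) (H : SimpleGraph W) : Prop :=
  ∃ B : W → Set V,
    (∀ w, (B w).Nonempty) ∧
      (∀ u v : W, u ≠ v → Disjoint (B u) (B v)) ∧
        (∀ w, (G.induce (B w)).Connected) ∧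
          ∀ u v : W, H.Adj u v → ∃ a ∈ B u, ∃ b ∈ B v, G.Adj a b

/-- A simple graph is *planar* if it contains neither `K₅` nor `K₃,₃` as a minor. -/
def IsPlanar {V : Type*} (G : SimpleGraph V) : Prop :=
  ¬ HasMinor G (completeGraph (Fin 5)) ∧
    ¬ HasMinor G (completeBipartiteGraph (Fin 3) (Fin 3))

namespace PathPairable

variable {V : Type*}

/-- The spanning subgraph of `G` whose edges are those with both ends in `U`. -/
def restrict (G : SimpleGraph V) (U : Set V) : SimpleGraph V where
  Adj x y := G.Adj x y ∧ x ∈ U ∧ y ∈ U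
  symm := ⟨fun _ _ h => ⟨h.1.symm, h.2.2, h.2.1⟩⟩
  loopless := ⟨fun _ h => G.loopless.irrefl _ h.1⟩

theorem restrict_le (G : SimpleGraph V) (U : Set V) : restrict G U ≤ G := fun _ _ h => h.1

theorem restrict_mono (G : SimpleGraph V) {U W : Set V} (h : U ⊆ W) :
    restrict G U ≤ restrict G W := fun _ _ h' => ⟨h'.1, h h'.2.1, h h'.2.2⟩

theorem mem_of_walk_restrict {G : SimpleGraph V} {U : Set V} {x y : V}
    (p : (restrict G U).Walk x y) (hx : x ∈ U) : ∀ z ∈ p.support, z ∈ U := by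
  induction p with
  | nil => simpa using hx
  | cons h p ih =>
    intro z hz
    rw [Walk.support_cons, List.mem_cons] at hz
    rcases hz with rfl | hz
    · exact hx
    · exact ih h.2.2 z hz

theorem mem_of_reachable_restrict {G : SimpleGraph V} {U : Set V} {x y : V}
    (h : (restrict G U).Reachable x y) (hx : x ∈ U) : y ∈ U := by
  obtain ⟨p⟩ := h
  exact mem_of_walk_restrict p hx y p.end_mem_support

theorem connected_induce_reachable (G : SimpleGraph V) (U : Set V) (x : V) :
    (G.induce {y | (restrict G U).Reachable x y}).Connected := by
  refine induce_connected_of_patches (G := G)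
    (s := {y | (restrict G U).Reachable x y}) x (Reachable.refl x) ?_
  rintro y ⟨p⟩
  refine ⟨{z | z ∈ (p.mapLe (restrict_le G U)).support}, ?_, by simp, by simp, ?_⟩
  · intro z hz
    have hz' : z ∈ p.support := by simpa using hz
    classical exact ⟨p.takeUntil z hz'⟩
  · exact (p.mapLe (restrict_le G U)).connected_induce_support.preconnected _ _

/-- A geodesic meets a ball of radius `r` in at most `2 * r + 1` vertices. -/
theorem ncard_geodesic_inter_ball_le {H : SimpleGraph V} {a b : V} (p : H.Walk a b)
    (hp : p.length = H.dist a b) (y : V) (r : ℕ) :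
    {w | w ∈ p.support ∧ ∃ q : H.Walk y w, q.length ≤ r}.ncard ≤ 2 * r + 1 := by
  classical
  have hsub : {w | w ∈ p.support ∧ ∃ q : H.Walk y w, q.length ≤ r} ⊆
      ↑((Finset.Icc (H.dist a y - r) (H.dist a y + r)).image p.getVert) := by
    rintro w ⟨hw, q, hq⟩
    have hspec := congrArg Walk.length (p.take_spec hw)
    rw [Walk.length_append] at hspec
    obtain ⟨s, hs⟩ := (p.takeUntil w hw).reachable.exists_walk_length_eq_dist
    obtain ⟨t, ht⟩ := ((p.takeUntil w hw).append q.reverse).reachable.exists_walk_length_eq_dist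
    have h1 := dist_le (t.append q)
    have h2 := dist_le (s.append q.reverse)
    have h3 := dist_le (s.append (p.dropUntil w hw))
    have h4 := dist_le (p.takeUntil w hw)
    simp only [Walk.length_append, Walk.length_reverse] at h1 h2 h3
    rw [Finset.mem_coe, Finset.mem_image]
    refine ⟨(p.takeUntil w hw).length, ?_, p.getVert_length_takeUntil hw⟩
    rw [Finset.mem_Icc]
    omega
  calc _ ≤ _ := Set.ncard_le_ncard hsub (Finset.finite_toSet _)
    _ ≤ _ := by
      rw [Set.ncard_coe_finset]
      refine Finset.card_image_le.trans ?_
      rw [Nat.card_Icc]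
      omega

/-- In a graph without a `K₅` minor, a connected set and pairwise adjacent connected sets
adjacent to it: there are at most three of the latter. -/
theorem card_le_three_of_not_hasMinor {G : SimpleGraph V}
    (hG : ¬ HasMinor G (completeGraph (Fin 5))) {D : Set V} (hD : (G.induce D).Connected)
    {B : ℕ → Set V} {N : Finset ℕ} (hconn : ∀ j ∈ N, (G.induce (B j)).Connected)
    (hdisj : ∀ i j, i ≠ j → Disjoint (B i) (B j)) (hDdisj : ∀ j ∈ N, Disjoint D (B j))
    (hadj : ∀ i ∈ N, ∀ j ∈ N, i ≠ j → ∃ a ∈ B i, ∃ b ∈ B j, G.Adj a b)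
    (hDadj : ∀ j ∈ N, ∃ a ∈ D, ∃ b ∈ B j, G.Adj a b) : N.card ≤ 3 := by
  by_contra! hlt
  obtain ⟨T, hTN, hT⟩ := Finset.exists_subset_card_eq (show 4 ≤ N.card from hlt)
  let e := T.orderEmbOfFin hT
  have he : ∀ i, e i ∈ N := fun i => hTN (T.orderEmbOfFin_mem hT i)
  have hne : ∀ i j, i ≠ j → e i ≠ e j := fun i j h h' => h (e.injective h')
  refine hG ⟨Fin.cons D fun i => B (e i), ?_, ?_, ?_, ?_⟩
  · intro w
    refine Fin.cases ?_ (fun i => ?_) w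
    · obtain ⟨x⟩ := hD.nonempty
      exact ⟨x, x.2⟩
    · obtain ⟨x⟩ := (hconn _ (he i)).nonempty
      exact ⟨x, x.2⟩
  · intro u v
    refine Fin.cases ?_ (fun i => ?_) u <;> refine Fin.cases ?_ (fun j => ?_) v
    · simp
    · intro _
      exact hDdisj _ (he j)
    · intro _
      exact (hDdisj _ (he i)).symm
    · intro h
      exact hdisj _ _ (hne i j fun h' => h (by rw [h']))
  · intro w
    refine Fin.cases ?_ (fun i => ?_) w
    · exact hD
    · exact hconn _ (he i)
  · intro u v huv
    have huv : u ≠ v := huv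
    revert huv
    refine Fin.cases ?_ (fun i => ?_) u <;> refine Fin.cases ?_ (fun j => ?_) v
    · simp
    · intro _
      exact hDadj _ (he j)
    · intro _
      obtain ⟨a, ha, b, hb, hab⟩ := hDadj _ (he i)
      exact ⟨b, hb, a, ha, hab.symm⟩
    · intro h
      exact hadj _ (he i) _ (he j) (hne i j fun h' => h (by rw [h']))

/-- The graph spanned by the vertices of index at least `j`. -/
abbrev upper (G : SimpleGraph V) (idx : V → ℕ) (j : ℕ) : SimpleGraph V :=
  restrict G {v | j ≤ idx v}

/-- The piece `j` of the partition of the vertices given by `idx` is separated from the earlier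
pieces by at most three of them, and meets balls of `upper G idx j` in few vertices. -/
structure IsGoodPiece (G : SimpleGraph V) (idx : V → ℕ) (j : ℕ) : Prop where
  exists_separating : ∃ N : Finset ℕ, N.card ≤ 3 ∧ ∀ y h z, idx h = j →
    (upper G idx j).Reachable y h → G.Adj y z → idx z < j → idx z ∈ N
  ncard_le : ∀ y r,
    {w | idx w = j ∧ ∃ p : (upper G idx j).Walk y w, p.length ≤ r}.ncard ≤ 4 * r + 2

/-- A stage of the construction: pieces of index less than `k` are final, and the vertices of
index `k` are still to be divided. -/
structure IsPartialDecomposition (G : SimpleGraph V) (idx : V → ℕ) (k : ℕ) : Prop where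
  le : ∀ v, idx v ≤ k
  good : ∀ j < k, IsGoodPiece G idx j
  connected : ∀ j < k, (G.induce {v | idx v = j}).Connected
  adj : ∀ x y a b, idx x = k → (upper G idx k).Reachable x y → G.Adj x a → G.Adj y b →
    idx a < idx b → idx b < k → ∃ a' b', idx a' = idx a ∧ idx b' = idx b ∧ G.Adj a' b'

theorem IsGoodPiece.congr {G : SimpleGraph V} {idx idx' : V → ℕ} {j : ℕ}
    (h : IsGoodPiece G idx j) (hlt : ∀ v, idx v ≤ j → idx' v = idx v)
    (hge : ∀ v, j < idx v → j < idx' v) : IsGoodPiece G idx' j := by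
  have hupper : upper G idx' j = upper G idx j := by
    unfold upper
    congr 1
    ext v
    grind
  have heq : ∀ v, idx' v = j ↔ idx v = j := by grind
  obtain ⟨⟨N, hN, hsep⟩, hcard⟩ := h
  refine ⟨⟨N, hN, ?_⟩, ?_⟩
  · rw [hupper]
    intro y h z hh hr ha hz
    have : idx' z = idx z := by grind
    rw [this]
    exact hsep y h z ((heq h).1 hh) hr ha (this ▸ hz)
  · rw [hupper]
    simpa only [heq] using hcard

theorem exists_three_cover {N : Finset ℕ} (hN : N.card ≤ 3) :
    ∃ a b c : ℕ, ∀ j ∈ N, j = a ∨ j = b ∨ j = c := by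
  rw [← Finset.length_toList] at hN
  refine ⟨N.toList.getD 0 0, N.toList.getD 1 0, N.toList.getD 2 0, fun j hj => ?_⟩
  rw [← Finset.mem_toList, List.mem_iff_getElem] at hj
  obtain ⟨i, hi, rfl⟩ := hj
  have : i = 0 ∨ i = 1 ∨ i = 2 := by omega
  rcases this with rfl | rfl | rfl
  exacts [Or.inl (List.getElem_eq_getD 0), Or.inr (Or.inl (List.getElem_eq_getD 0)),
    Or.inr (Or.inr (List.getElem_eq_getD 0))]

set_option maxHeartbeats 800000 in
/-- In a graph without a `K₅` minor, one more piece can be carved out of the part of the vertex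
set which is still to be divided. -/
theorem IsPartialDecomposition.exists_succ [Finite V] {G : SimpleGraph V} {idx : V → ℕ} {k : ℕ}
    (hG : ¬ HasMinor G (completeGraph (Fin 5))) (h : IsPartialDecomposition G idx k) {x₀ : V}
    (hx₀ : idx x₀ = k) : ∃ idx' : V → ℕ, IsPartialDecomposition G idx' (k + 1) ∧
      {v | idx' v = k + 1} ⊂ {v | idx v = k} := by
  classical
  have hle := h.le
  let D : Set V := {y | (upper G idx k).Reachable x₀ y}
  have hDk : ∀ y ∈ D, idx y = k := fun y hy =>
    le_antisymm (hle y) (mem_of_reachable_restrict (U := {v | k ≤ idx v}) hy hx₀.ge)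
  have hx₀D : x₀ ∈ D := Reachable.refl x₀
  let N : Finset ℕ := (Finset.range k).filter fun j => ∃ y ∈ D, ∃ a, G.Adj y a ∧ idx a = j
  have hNk : ∀ j ∈ N, j < k := fun j hj => Finset.mem_range.1 (Finset.mem_filter.1 hj).1
  have hND : ∀ j ∈ N, ∃ y ∈ D, ∃ a, G.Adj y a ∧ idx a = j := fun j hj =>
    (Finset.mem_filter.1 hj).2
  have hadj : ∀ i ∈ N, ∀ j ∈ N, i < j →
      ∃ a' b', idx a' = i ∧ idx b' = j ∧ G.Adj a' b' := by
    intro i hi j hj hij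
    obtain ⟨y, hy, a, hya, rfl⟩ := hND i hi
    obtain ⟨z, hz, b, hzb, rfl⟩ := hND j hj
    exact h.adj y z a b (hDk y hy) (hy.symm.trans hz) hya hzb hij (hNk _ hj)
  have hN : N.card ≤ 3 := by
    refine card_le_three_of_not_hasMinor hG (D := D)
      (connected_induce_reachable G _ x₀) (B := fun j => {v | idx v = j}) (fun j hj => h.connected j (hNk j hj)) ?_ ?_ ?_ ?_
    · exact fun i j hij => Set.disjoint_left.2 fun v hi hj => hij (hi.symm.trans hj)
    · exact fun j hj => Set.disjoint_left.2 fun v hv hvj =>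
        (hNk j hj).ne (hvj.symm.trans (hDk v hv))
    · intro i hi j hj hij
      rcases hij.lt_or_gt with hij | hij
      · obtain ⟨a, b, ha, hb, hab⟩ := hadj i hi j hj hij
        exact ⟨a, ha, b, hb, hab⟩
      · obtain ⟨a, b, ha, hb, hab⟩ := hadj j hj i hi hij
        exact ⟨b, hb, a, ha, hab.symm⟩
    · intro j hj
      obtain ⟨y, hy, a, hya, ha⟩ := hND j hj
      exact ⟨y, hy, a, ha, hya⟩
  have hex : ∀ j, ∃ y ∈ D, j ∈ N → ∃ a, G.Adj y a ∧ idx a = j := by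
    intro j
    by_cases hj : j ∈ N
    · obtain ⟨y, hy, hya⟩ := hND j hj
      exact ⟨y, hy, fun _ => hya⟩
    · exact ⟨x₀, hx₀D, fun hj' => absurd hj' hj⟩
  choose g hgD hgN using hex
  obtain ⟨a, b, c, habc⟩ := exists_three_cover hN
  have hreach : ∀ i j, (upper G idx k).Reachable (g i) (g j) := fun i j =>
    (hgD i).symm.trans (hgD j)
  obtain ⟨p, hp⟩ := (hreach a b).exists_walk_length_eq_dist
  obtain ⟨q, hq⟩ := (hreach a c).exists_walk_length_eq_dist
  let S : Set V := {v | v ∈ p.support} ∪ {v | v ∈ q.support}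
  have hSD : ∀ v ∈ S, v ∈ D := by
    rintro v (hv | hv)
    · exact (hgD a).trans (p.takeUntil v hv).reachable
    · exact (hgD a).trans (q.takeUntil v hv).reachable
  have hgS : ∀ j ∈ N, g j ∈ S := by
    intro j hj
    rcases habc j hj with rfl | rfl | rfl
    · exact Or.inl p.start_mem_support
    · exact Or.inl p.end_mem_support
    · exact Or.inr q.end_mem_support
  have hSk : ∀ v ∈ S, idx v = k := fun v hv => hDk v (hSD v hv)
  have hgaS : g a ∈ S := Or.inl p.start_mem_support
  let idx' : V → ℕ := fun v => if idx v = k ∧ v ∉ S then k + 1 else idx v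
  have hlt : ∀ v, idx v < k → idx' v = idx v := fun v hv => if_neg fun h => hv.ne h.1
  have hmem : ∀ v ∈ S, idx' v = k := fun v hv => (if_neg fun h => h.2 hv).trans (hSk v hv)
  have hnot : ∀ v, idx v = k → v ∉ S → idx' v = k + 1 := fun v hv hvS => if_pos ⟨hv, hvS⟩
  clear_value idx'
  have heqk : ∀ v, idx' v = k ↔ v ∈ S := by grind
  have hupper : upper G idx' k = upper G idx k := by
    unfold upper
    congr 1
    ext v
    simp only [Set.mem_ofPred_eq]
    grind
  refine ⟨idx', ⟨?_, ?_, ?_, ?_⟩, ?_⟩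
  · grind
  · intro j hj
    rcases (Nat.lt_succ_iff_lt_or_eq.1 hj) with hj | rfl
    · exact (h.good j hj).congr (by grind) (by grind)
    refine ⟨⟨N, hN, ?_⟩, ?_⟩
    · rw [hupper]
      intro y w z hw hr hyz hz
      have hz' : idx z < j := by grind
      rw [hlt z hz']
      have hy : y ∈ D := (hSD w ((heqk w).1 hw)).trans hr.symm
      exact Finset.mem_filter.2 ⟨Finset.mem_range.2 hz', y, hy, z, hyz, rfl⟩
    · intro y r
      rw [hupper]
      have hsub : {w | idx' w = j ∧ ∃ p : (upper G idx j).Walk y w, p.length ≤ r} ⊆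
          {w | w ∈ p.support ∧ ∃ q : (upper G idx j).Walk y w, q.length ≤ r} ∪
          {w | w ∈ q.support ∧ ∃ q : (upper G idx j).Walk y w, q.length ≤ r} := by
        rintro w ⟨hw, hr⟩
        rcases (heqk w).1 hw with hw | hw
        · exact Or.inl ⟨hw, hr⟩
        · exact Or.inr ⟨hw, hr⟩
      have h1 := Set.ncard_le_ncard hsub (Set.toFinite _)
      have h2 := h1.trans (Set.ncard_union_le _ _)
      have h3 := ncard_geodesic_inter_ball_le p hp y r
      have h4 := ncard_geodesic_inter_ball_le q hq y r
      omega
  · intro j hj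
    rcases (Nat.lt_succ_iff_lt_or_eq.1 hj) with hj | rfl
    · have : {v | idx' v = j} = {v | idx v = j} := by
        ext v
        simp only [Set.mem_ofPred_eq]
        grind
      rw [this]
      exact h.connected j hj
    · have : {v | idx' v = j} = S := Set.ext heqk
      rw [this]
      have hp' := (p.mapLe (restrict_le G _)).connected_induce_support
      have hq' := (q.mapLe (restrict_le G _)).connected_induce_support
      rw [Walk.support_mapLe_eq_support] at hp' hq'
      exact induce_union_connected hp'.preconnected hq'.preconnected
        ⟨g a, p.start_mem_support, q.start_mem_support⟩
  · intro x y u w hx hxy hxu hyw huw hw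
    have hy : k + 1 ≤ idx' y :=
      mem_of_reachable_restrict (U := {v | k + 1 ≤ idx' v}) hxy hx.ge
    have hxy' : (upper G idx k).Reachable x y := by
      rw [← hupper]
      exact hxy.mono (restrict_mono G fun v (hv : k + 1 ≤ idx' v) => (Nat.le_succ k).trans hv)
    have hxk : idx x = k := by grind
    have hyk : idx y = k := by grind
    rcases (Nat.lt_succ_iff_lt_or_eq.1 hw) with hw | hw
    · obtain ⟨a', b', ha', hb', hab⟩ := h.adj x y u w hxk hxy' hxu hyw (by grind) (by grind)
      exact ⟨a', b', by grind, by grind, hab⟩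
    · have hwS := (heqk w).1 hw
      have hwy : (upper G idx k).Adj w y := ⟨hyw.symm, (hSk w hwS).ge, hyk.ge⟩
      have hxD : x ∈ D := ((hSD w hwS).trans hwy.reachable).trans hxy'.symm
      have huk : idx u < k := by grind
      have huN : idx u ∈ N :=
        Finset.mem_filter.2 ⟨Finset.mem_range.2 huk, x, hxD, u, hxu, rfl⟩
      obtain ⟨a', ha', hau⟩ := hgN _ huN
      exact ⟨a', g (idx u), by grind, by grind, ha'.symm⟩
  · refine Set.ssubset_iff_subset_ne.2 ⟨?_, ?_⟩
    · intro v hv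
      simp only [Set.mem_ofPred_eq] at hv ⊢
      grind
    · intro heq
      have : g a ∈ {v | idx' v = k + 1} := heq ▸ hSk _ hgaS
      simp only [Set.mem_ofPred_eq] at this
      grind

theorem IsPartialDecomposition.exists_isGoodPiece [Finite V] {G : SimpleGraph V}
    (hG : ¬ HasMinor G (completeGraph (Fin 5))) (m : ℕ) :
    ∀ (idx : V → ℕ) (k : ℕ), IsPartialDecomposition G idx k → {v | idx v = k}.ncard ≤ m →
      ∃ idx' : V → ℕ, ∀ j, IsGoodPiece G idx' j := by
  induction m with
  | zero =>
    intro idx k h hm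
    rw [Nat.le_zero, Set.ncard_eq_zero] at hm
    have hne : ∀ v, idx v ≠ k := fun v hv => (hm ▸ hv : v ∈ (∅ : Set V))
    refine ⟨idx, fun j => ?_⟩
    rcases lt_or_ge j k with hj | hj
    · exact h.good j hj
    · have hnej : ∀ v, idx v ≠ j := fun v hv => hne v (le_antisymm (h.le v) (hv ▸ hj))
      exact ⟨⟨∅, by simp, fun _ w _ hw => absurd hw (hnej w)⟩, by simp [hnej]⟩
  | succ m ih =>
    intro idx k h hm
    by_cases hx : ∃ x, idx x = k
    · obtain ⟨x, hx⟩ := hx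
      obtain ⟨idx', h', hss⟩ := h.exists_succ hG hx
      have := Set.ncard_lt_ncard hss
      exact ih idx' (k + 1) h' (by omega)
    · have : {v | idx v = k} = ∅ := Set.eq_empty_of_forall_notMem fun v hv => hx ⟨v, hv⟩
      exact ih idx k h (by simp [this])

theorem exists_isGoodPiece [Finite V] {G : SimpleGraph V}
    (hG : ¬ HasMinor G (completeGraph (Fin 5))) :
    ∃ idx : V → ℕ, ∀ j, IsGoodPiece G idx j :=
  IsPartialDecomposition.exists_isGoodPiece hG _ (fun _ => 0) 0
    ⟨fun _ => le_rfl, by simp, by simp, by simp⟩ le_rfl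

/-- The vertices `w` joined to `u` by a walk of length at most `r` on which the index is at
least that of `w`. -/
def weakBall (G : SimpleGraph V) (idx : V → ℕ) (r : ℕ) (u : V) : Set V :=
  {w | ∃ p : (upper G idx (idx w)).Walk u w, p.length ≤ r}

theorem exists_finset_index {G : SimpleGraph V} {idx : V → ℕ}
    (hidx : ∀ j, IsGoodPiece G idx j) (r : ℕ) :
    ∀ j, ∃ I : Finset ℕ, I.card ≤ 4 ^ r ∧ ∀ u h i w, j ≤ idx u → idx h = j →
      (upper G idx j).Reachable u h → i ≤ j → idx w = i →
      (∃ p : (upper G idx i).Walk u w, p.length ≤ r) → i ∈ I := by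
  classical
  induction r with
  | zero =>
    refine fun j => ⟨{j}, by simp, fun u h i w hu _ _ hij hw ⟨p, hp⟩ => ?_⟩
    obtain rfl := Walk.eq_of_length_eq_zero (Nat.le_zero.1 hp)
    rw [Finset.mem_singleton]
    omega
  | succ r ih =>
    choose I hI hmem using ih
    intro j
    obtain ⟨N, hN, hsep⟩ := (hidx j).exists_separating
    refine ⟨I j ∪ N.biUnion I, ?_, ?_⟩
    · have h1 : (N.biUnion I).card ≤ N.card * 4 ^ r :=
        Finset.card_biUnion_le_card_mul _ _ _ fun i _ => hI i
      have h2 := Nat.mul_le_mul_right (4 ^ r) hN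
      have h3 := Finset.card_union_le (I j) (N.biUnion I)
      have h4 := hI j
      rw [pow_succ]
      omega
    · rintro u h i w hu hh hr hij hw ⟨p, hp⟩
      rw [Finset.mem_union]
      cases p with
      | nil => exact Or.inl (hmem j u h i u hu hh hr hij hw ⟨Walk.nil, Nat.zero_le r⟩)
      | @cons _ u' _ ha p =>
        have hp' : p.length ≤ r := by simpa using hp
        rcases lt_or_ge (idx u') j with hlt | hge
        · refine Or.inr (Finset.mem_biUnion.2 ⟨idx u', hsep u h u' hh hr ha.1 hlt, ?_⟩)
          exact hmem (idx u') u' u' i w le_rfl rfl (Reachable.refl _) ha.2.2 hw ⟨p, hp'⟩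
        · have ha' : (upper G idx j).Adj u' u := ⟨ha.1.symm, hge, hu⟩
          exact Or.inl (hmem j u' h i w hge hh (ha'.reachable.trans hr) hij hw ⟨p, hp'⟩)

theorem ncard_weakBall_le [Finite V] {G : SimpleGraph V} {idx : V → ℕ}
    (hidx : ∀ j, IsGoodPiece G idx j) (r : ℕ) (u : V) :
    (weakBall G idx r u).ncard ≤ 4 ^ r * (4 * r + 2) := by
  obtain ⟨I, hI, hmem⟩ := exists_finset_index hidx r (idx u)
  have hsub : weakBall G idx r u ⊆ ⋃ i ∈ I,
      {w | idx w = i ∧ ∃ p : (upper G idx i).Walk u w, p.length ≤ r} := by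
    rintro w ⟨p, hp⟩
    have hle : idx w ≤ idx u := by
      cases p with
      | nil => exact le_rfl
      | cons ha p => exact ha.2.1
    refine Set.mem_biUnion (hmem u u _ w le_rfl rfl (Reachable.refl _) hle rfl ⟨p, hp⟩) ?_
    exact ⟨rfl, p, hp⟩
  calc _ ≤ _ := Set.ncard_le_ncard hsub (Set.toFinite _)
    _ ≤ _ := Finset.set_ncard_biUnion_le I _
    _ ≤ I.card * (4 * r + 2) := by
      rw [← smul_eq_mul]
      exact Finset.sum_le_card_nsmul _ _ _ fun i _ => (hidx i).ncard_le u r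
    _ ≤ _ := Nat.mul_le_mul_right _ hI

/-- The vertex of least index on a walk weakly reaches both ends. -/
theorem exists_mem_weakBall_inter {G : SimpleGraph V} (idx : V → ℕ) {u v : V} (p : G.Walk u v)
    {r : ℕ} (hp : p.length ≤ r) :
    ∃ w ∈ p.support, w ∈ weakBall G idx r u ∧ w ∈ weakBall G idx r v := by
  classical
  obtain ⟨w, hw, hmin⟩ := p.support.toFinset.exists_min_image idx ⟨u, by simp⟩
  rw [List.mem_toFinset] at hw
  have key : ∀ {x y : V} (q : G.Walk x y), (∀ z ∈ q.support, z ∈ p.support) →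
      ∃ q' : (upper G idx (idx w)).Walk x y, q'.length = q.length := by
    intro x y q hq
    refine ⟨q.transfer _ fun e he => ?_, q.length_transfer _⟩
    induction e with
    | h a b =>
      exact ⟨q.adj_of_mem_edges he,
        hmin a (List.mem_toFinset.2 (hq a (q.fst_mem_support_of_mem_edges he))),
        hmin b (List.mem_toFinset.2 (hq b (q.snd_mem_support_of_mem_edges he)))⟩
  obtain ⟨q₁, hq₁⟩ := key (p.takeUntil w hw) fun z hz => p.support_takeUntil_subset_support hw hz
  obtain ⟨q₂, hq₂⟩ := key (p.dropUntil w hw).reverse fun z hz =>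
    p.support_dropUntil_subset_support hw (by simpa using hz)
  have hlen := congrArg Walk.length (p.take_spec hw)
  rw [Walk.length_append] at hlen
  rw [Walk.length_reverse] at hq₂
  exact ⟨w, hw, ⟨q₁, by omega⟩, ⟨q₂, by omega⟩⟩

theorem card_edgeFinset_le [Fintype V] {G : SimpleGraph V} [Fintype G.edgeSet] (idx : V → ℕ)
    {k : ℕ} (hk : ∀ v, (weakBall G idx 1 v).ncard ≤ k) :
    G.edgeFinset.card ≤ Fintype.card V * k := by
  classical
  have hsub : G.edgeFinset ⊆ Finset.univ.biUnion fun v =>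
      (weakBall G idx 1 v).toFinset.image fun u => s(u, v) := by
    intro e he
    induction e with
    | h a b =>
      have hab : G.Adj a b := by simpa using he
      have key : ∀ {x y : V}, G.Adj x y → idx x ≤ idx y → x ∈ weakBall G idx 1 y :=
        fun {x y} hxy hle =>
          ⟨(show (upper G idx (idx x)).Adj y x from ⟨hxy.symm, hle, le_refl (idx x)⟩).toWalk, by simp⟩
      rw [Finset.mem_biUnion]
      rcases le_total (idx a) (idx b) with h | h
      · exact ⟨b, Finset.mem_univ _, Finset.mem_image.2
          ⟨a, Set.mem_toFinset.2 (key hab h), rfl⟩⟩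
      · exact ⟨a, Finset.mem_univ _, Finset.mem_image.2
          ⟨b, Set.mem_toFinset.2 (key hab.symm h), Sym2.eq_swap⟩⟩
  refine (Finset.card_le_card hsub).trans (Finset.card_biUnion_le_card_mul _ _ _ fun v _ => ?_)
  refine Finset.card_image_le.trans ?_
  rw [← Set.ncard_eq_toFinset_card']
  exact hk v

/-- A set of even size can be paired so that few of its elements are paired with a relative,
if every element has few relatives. -/
theorem exists_pairing_avoiding [Fintype V] [DecidableEq V] (r : V → V → Prop) [DecidableRel r]
    (hr : ∀ u v, r u v → r v u) {d : ℕ}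
    (hd : ∀ v, (Finset.univ.filter fun u => r v u).card ≤ d) (m : ℕ) :
    ∀ T : Finset V, T.card = 2 * m → ∃ f : V → V, Function.Involutive f ∧
      (∀ v, f v ≠ v ↔ v ∈ T) ∧ (T.filter fun v => r v (f v)).card ≤ d + 1 := by
  induction m with
  | zero =>
    intro T hT
    obtain rfl : T = ∅ := by simpa using hT
    exact ⟨id, fun _ => rfl, by simp, by simp⟩
  | succ m ih =>
    intro T hT
    obtain ⟨v, hv⟩ : T.Nonempty := Finset.card_pos.1 (by omega)
    have hcard : (T.erase v).card = 2 * m + 1 := by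
      rw [Finset.card_erase_of_mem hv]
      omega
    obtain ⟨u, hu, hgood⟩ : ∃ u ∈ T.erase v, d + 1 < T.card → ¬ r v u := by
      by_cases hlt : d + 1 < T.card
      · by_contra! hall
        have hsub : T.erase v ⊆ Finset.univ.filter fun u => r v u := fun u hu =>
          Finset.mem_filter.2 ⟨Finset.mem_univ _, (hall u hu).2⟩
        have := (Finset.card_le_card hsub).trans (hd v)
        omega
      · obtain ⟨u, hu⟩ : (T.erase v).Nonempty := Finset.card_pos.1 (by omega)
        exact ⟨u, hu, fun h => absurd h hlt⟩
    have huv : u ≠ v := Finset.ne_of_mem_erase hu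
    have huT : u ∈ T := Finset.mem_of_mem_erase hu
    obtain ⟨f, hf, hfT, hbad⟩ := ih ((T.erase v).erase u) (by
      rw [Finset.card_erase_of_mem hu]
      omega)
    have hfu : f u = u := by
      by_contra h
      exact Finset.notMem_erase _ _ ((hfT u).1 h)
    have hfv : f v = v := by
      by_contra h
      exact Finset.notMem_erase _ _ (Finset.mem_of_mem_erase ((hfT v).1 h))
    have hne : ∀ x, x ≠ u → x ≠ v → f x ≠ u ∧ f x ≠ v := fun x hxu hxv =>
      ⟨fun h => hxu (hf.injective (h.trans hfu.symm)),
        fun h => hxv (hf.injective (h.trans hfv.symm))⟩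
    let f' : V → V := fun x => if x = u then v else if x = v then u else f x
    have hu' : f' u = v := if_pos rfl
    have hv' : f' v = u := by simp [f', huv.symm]
    have hx' : ∀ x, x ≠ u → x ≠ v → f' x = f x := fun x hxu hxv => by simp [f', hxu, hxv]
    clear_value f'
    refine ⟨f', ?_, ?_, ?_⟩
    · intro x
      by_cases hxu : x = u
      · rw [hxu, hu', hv']
      by_cases hxv : x = v
      · rw [hxv, hv', hu']
      rw [hx' x hxu hxv, hx' _ (hne x hxu hxv).1 (hne x hxu hxv).2, hf x]
    · intro x
      by_cases hxu : x = u
      · simp [hxu, hu', huv.symm, huT]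
      by_cases hxv : x = v
      · simp [hxv, hv', huv, hv]
      rw [hx' x hxu hxv, hfT, Finset.mem_erase, Finset.mem_erase]
      exact ⟨fun h => h.2.2, fun h => ⟨hxu, hxv, h⟩⟩
    · by_cases hlt : d + 1 < T.card
      · refine (Finset.card_le_card ?_).trans hbad
        intro x hx
        rw [Finset.mem_filter] at hx ⊢
        have hxu : x ≠ u := by
          rintro rfl
          exact hgood hlt (hr _ _ (hu' ▸ hx.2))
        have hxv : x ≠ v := by
          rintro rfl
          exact hgood hlt (hv' ▸ hx.2)
        exact ⟨Finset.mem_erase.2 ⟨hxu, Finset.mem_erase.2 ⟨hxv, hx.1⟩⟩, hx' x hxu hxv ▸ hx.2⟩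
      · exact (Finset.card_filter_le _ _).trans (not_lt.1 hlt)

section EdgeDisjoint

variable [DecidableEq V] {G : SimpleGraph V} {f : V → V} {P : (v : V) → G.Walk v (f v)}

theorem card_filter_mem_edges_le_two
    (hP : ∀ u v : V, u ≠ v → u ≠ f v → List.Disjoint (P u).edges (P v).edges) (e : Sym2 V)
    (s : Finset V) : (s.filter fun v => e ∈ (P v).edges).card ≤ 2 := by
  rcases (s.filter fun v => e ∈ (P v).edges).eq_empty_or_nonempty with h | ⟨v, hv⟩
  · simp [h]
  · refine (Finset.card_le_card (t := {v, f v}) fun u hu => ?_).trans Finset.card_le_two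
    rw [Finset.mem_insert, Finset.mem_singleton]
    by_contra! hne
    exact hP u v hne.1 hne.2 (Finset.mem_filter.1 hu).2 (Finset.mem_filter.1 hv).2

/-- Few of the edge-disjoint paths are long. -/
theorem card_filter_lt_length_mul_le [Fintype V] [Fintype G.edgeSet] (hpath : ∀ v, (P v).IsPath)
    (hP : ∀ u v : V, u ≠ v → u ≠ f v → List.Disjoint (P u).edges (P v).edges) (r : ℕ) :
    (Finset.univ.filter fun v => r < (P v).length).card * r ≤ G.edgeFinset.card * 2 := by
  refine Finset.card_mul_le_card_mul (fun v e => e ∈ (P v).edges) (fun v hv => ?_)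
    fun e _ => card_filter_mem_edges_le_two hP e _
  have hsub : (P v).edges.toFinset ⊆
      G.edgeFinset.bipartiteAbove (fun v e => e ∈ (P v).edges) v := fun e he => by
    rw [List.mem_toFinset] at he
    exact Finset.mem_filter.2 ⟨mem_edgeFinset.2 ((P v).edges_subset_edgeSet he), he⟩
  have := Finset.card_le_card hsub
  rw [List.toFinset_card_of_nodup (hpath v).isTrail.edges_nodup, Walk.length_edges] at this
  exact (Finset.mem_filter.1 hv).2.le.trans this

/-- Few of the edge-disjoint paths pass through a given vertex. -/
theorem card_filter_mem_support_le [Fintype V] [DecidableRel G.Adj] (hf : ∀ v, f v ≠ v)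
    (hP : ∀ u v : V, u ≠ v → u ≠ f v → List.Disjoint (P u).edges (P v).edges) (w : V) :
    (Finset.univ.filter fun v => w ∈ (P v).support).card ≤ G.maxDegree * 2 := by
  refine le_trans ?_ (Nat.mul_le_mul_right 2 (G.degree_le_maxDegree w))
  rw [← card_incidenceFinset_eq_degree,
    ← mul_one (Finset.univ.filter fun v => w ∈ (P v).support).card]
  refine Finset.card_mul_le_card_mul (fun v e => e ∈ (P v).edges) (fun v hv => ?_)
    fun e _ => card_filter_mem_edges_le_two hP e _
  have hnil : ¬ (P v).Nil := fun h => hf v h.eq.symm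
  obtain ⟨e, he, hwe⟩ :=
    (Walk.mem_support_iff_exists_mem_edges_of_not_nil hnil).1 (Finset.mem_filter.1 hv).2
  exact Finset.card_pos.2 ⟨e, Finset.mem_filter.2
    ⟨(G.mem_incidenceFinset w e).2 ⟨(P v).edges_subset_edgeSet he, hwe⟩, he⟩⟩

end EdgeDisjoint

/-- If every vertex is assigned at most `k` hubs so that each path of length at most `192` runs
through a common hub of its ends, and the graph has at most `24 * n` edges, then
path-pairability forces a vertex of linear degree. -/
theorem IsPathPairable.card_le_mul_maxDegree [Fintype V] [DecidableEq V] {G : SimpleGraph V}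
    [DecidableRel G.Adj] (hG : IsPathPairable G)
    (hedge : G.edgeFinset.card ≤ Fintype.card V * 24) (W : V → Finset V) {k : ℕ} (hk : 0 < k)
    (hW : ∀ v, (W v).card ≤ k)
    (hub : ∀ u v (p : G.Walk u v), p.length ≤ 192 → ∃ w ∈ p.support, w ∈ W u ∧ w ∈ W v) :
    Fintype.card V ≤ 18 * k ^ 2 * G.maxDegree := by
  obtain ⟨⟨m, hm⟩, hpair⟩ := hG
  rcases Nat.eq_zero_or_pos (Fintype.card V) with hn | hn
  · omega
  set n := Fintype.card V with hn_def
  let pop : V → ℕ := fun w => (Finset.univ.filter fun v => w ∈ W v).card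
  let H : Finset V := Finset.univ.filter fun w => n ≤ pop w * (4 * k)
  have hH : H.card ≤ 4 * k * k := by
    have h1 : ∑ w, pop w = ∑ v, (W v).card := by
      have := Finset.sum_card_bipartiteAbove_eq_sum_card_bipartiteBelow (s := Finset.univ)
        (t := Finset.univ) (fun v w => w ∈ W v)
      simp only [Finset.bipartiteAbove, Finset.bipartiteBelow, Finset.filter_univ_mem] at this
      exact this.symm
    have h2 : ∑ v, (W v).card ≤ n * k := by
      rw [hn_def, ← Finset.card_univ, ← smul_eq_mul]
      exact Finset.sum_le_card_nsmul _ _ _ fun v _ => hW v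
    have h3 : H.card * n ≤ ∑ w ∈ H, pop w * (4 * k) := by
      rw [← smul_eq_mul]
      exact Finset.card_nsmul_le_sum _ _ _ fun w hw => (Finset.mem_filter.1 hw).2
    have h4 : ∑ w ∈ H, pop w ≤ ∑ w, pop w :=
      Finset.sum_le_sum_of_subset (Finset.subset_univ _)
    rw [← Finset.sum_mul] at h3
    have h5 := Nat.mul_le_mul_right (4 * k) (h4.trans (h1.le.trans h2))
    refine Nat.le_of_mul_le_mul_right ?_ hn
    calc H.card * n ≤ _ := h3
      _ ≤ _ := h5
      _ = 4 * k * k * n := by ring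
  let r : V → V → Prop := fun u v => ∃ w, w ∉ H ∧ w ∈ W u ∧ w ∈ W v
  have hrcard : ∀ v, (Finset.univ.filter fun u => r v u).card ≤ n / 4 := by
    intro v
    have hsub : (Finset.univ.filter fun u => r v u) ⊆
        ((W v).filter fun w => w ∉ H).biUnion fun w => Finset.univ.filter fun u => w ∈ W u := by
      intro u hu
      obtain ⟨w, hwH, hwv, hwu⟩ := (Finset.mem_filter.1 hu).2
      exact Finset.mem_biUnion.2 ⟨w, Finset.mem_filter.2 ⟨hwv, hwH⟩,
        Finset.mem_filter.2 ⟨Finset.mem_univ _, hwu⟩⟩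
    have h1 : (Finset.univ.filter fun u => r v u).card ≤ ∑ w ∈ (W v).filter (· ∉ H), pop w :=
      (Finset.card_le_card hsub).trans Finset.card_biUnion_le
    have h2 : ∑ w ∈ (W v).filter (· ∉ H), pop w * (4 * k) ≤ k * n := by
      refine (Finset.sum_le_card_nsmul _ _ n fun w hw => ?_).trans ?_
      · by_contra! hlt
        exact (Finset.mem_filter.1 hw).2 (Finset.mem_filter.2 ⟨Finset.mem_univ _, hlt.le⟩)
      · rw [smul_eq_mul]
        exact Nat.mul_le_mul_right _ ((Finset.card_filter_le _ _).trans (hW v))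
    rw [← Finset.sum_mul] at h2
    rw [Nat.le_div_iff_mul_le (by norm_num)]
    refine Nat.le_of_mul_le_mul_right (le_trans (le_of_eq ?_)
      ((Nat.mul_le_mul_right (4 * k) h1).trans (h2.trans_eq (mul_comm _ _)))) hk
    ring
  classical
  obtain ⟨f, hf, hfuniv, hbad⟩ := exists_pairing_avoiding r
    (fun u v ⟨w, hw, hu, hv⟩ => ⟨w, hw, hv, hu⟩) (fun v => by convert hrcard v) m
    Finset.univ (by rw [Finset.card_univ]; omega)
  have hfne : ∀ v, f v ≠ v := fun v => (hfuniv v).2 (Finset.mem_univ v)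
  obtain ⟨P, hpath, hP⟩ := hpair f hf hfne
  have hlong := card_filter_lt_length_mul_le hpath hP 192
  have hthrough := card_filter_mem_support_le hfne hP
  have hcover : (Finset.univ : Finset V) ⊆ ((Finset.univ.filter fun v => 192 < (P v).length) ∪
      H.biUnion fun w => Finset.univ.filter fun v => w ∈ (P v).support) ∪
      Finset.univ.filter fun v => r v (f v) := by
    intro v _
    simp only [Finset.mem_union, Finset.mem_biUnion, Finset.mem_filter, Finset.mem_univ, true_and]
    by_cases hlt : 192 < (P v).length
    · exact Or.inl (Or.inl hlt)
    · obtain ⟨w, hw, hwv, hwf⟩ := hub v (f v) (P v) (not_lt.1 hlt)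
      by_cases hwH : w ∈ H
      · exact Or.inl (Or.inr ⟨w, hwH, hw⟩)
      · exact Or.inr ⟨w, hwH, hwv, hwf⟩
  have h1 := Finset.card_le_card hcover
  have h2 := h1.trans (Finset.card_union_le _ _)
  have h3 := h2.trans (Nat.add_le_add_right (Finset.card_union_le _ _) _)
  have h4 := (Finset.card_biUnion_le_card_mul H _ _ fun w _ => hthrough w).trans
    (Nat.mul_le_mul_right _ hH)
  rw [Finset.card_univ, ← hn_def] at h3
  have hdeg : 1 ≤ G.maxDegree := by
    obtain ⟨v⟩ := Fintype.card_pos_iff.1 hn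
    have hv : v ∈ Finset.univ.filter fun u => v ∈ (P u).support :=
      Finset.mem_filter.2 ⟨Finset.mem_univ v, (P v).start_mem_support⟩
    have := (Finset.card_pos.2 ⟨v, hv⟩).trans_le (hthrough v)
    omega
  have h5 : 1 ≤ k ^ 2 * G.maxDegree := Nat.mul_pos (pow_pos hk 2) hdeg
  have h6 : 4 * k * k * (G.maxDegree * 2) = 8 * (k ^ 2 * G.maxDegree) := by ring
  rw [h6] at h4
  rw [mul_assoc]
  omega

theorem card_le_mul_maxDegree_of_not_hasMinor [Fintype V] {G : SimpleGraph V}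
    [DecidableRel G.Adj] (hG : IsPathPairable G)
    (hminor : ¬ HasMinor G (completeGraph (Fin 5))) :
    Fintype.card V ≤ 10 ^ 250 * G.maxDegree := by
  classical
  obtain ⟨idx, hidx⟩ := exists_isGoodPiece hminor
  have hedge := card_edgeFinset_le (G := G) idx (ncard_weakBall_le hidx 1)
  have hball := ncard_weakBall_le hidx 192
  simp only [Set.ncard_eq_toFinset_card'] at hball
  have h := IsPathPairable.card_le_mul_maxDegree hG hedge
    (fun v => (weakBall G idx 192 v).toFinset) (by positivity) hball
    (fun u v p hp => by simpa using exists_mem_weakBall_inter idx p hp)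
  refine h.trans (Nat.mul_le_mul_right _ ?_)
  norm_num

end PathPairable

/-- There exists `c ≥ 10 ^ (-10 ^ 10)` such that every path-pairable planar simple graph on
`n` vertices has maximum degree at least `c * n`. -/
theorem statement_0 :
    ∃ c : ℝ, c ≥ (10 : ℝ) ^ (-(10 : ℝ) ^ (10 : ℕ)) ∧
      ∀ (V : Type) [Fintype V] (G : SimpleGraph V) [DecidableRel G.Adj],
        IsPathPairable G → IsPlanar G →
          c * (Fintype.card V : ℝ) ≤ (G.maxDegree : ℝ) := by
  refine ⟨(10 : ℝ) ^ (-(250 : ℝ)), ?_, fun V _ G _ hpair hplanar => ?_⟩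
  · refine Real.rpow_le_rpow_of_exponent_le (by norm_num) ?_
    norm_num
  · have h : (Fintype.card V : ℝ) ≤ (10 : ℝ) ^ 250 * G.maxDegree := by
      exact_mod_cast PathPairable.card_le_mul_maxDegree_of_not_hasMinor hpair hplanar.1
    have hpow : (10 : ℝ) ^ (-(250 : ℝ)) = ((10 : ℝ) ^ 250)⁻¹ := by
      rw [Real.rpow_neg (by norm_num)]
      congr 1
      exact_mod_cast Real.rpow_natCast 10 250
    rw [hpow, inv_mul_le_iff₀ (by positivity)]
    exact h
end

section
/- If G is a path-pairable simple graph on n vertices with maximum degree Δ, then n ≤ 2·Δ^Δ. -/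
open SimpleGraph

/-- The geometric sum bounding the size of a ball, compared with the binomial theorem. -/
lemma sum_range_pred_pow_le (d : ℕ) :
    ∑ i ∈ Finset.range d, d * (d - 1) ^ i ≤ d ^ d := by
  rcases d with _ | d
  · simp
  rw [← Finset.mul_sum, pow_succ', Nat.add_sub_cancel, add_pow]
  refine Nat.mul_le_mul_left _ (Finset.sum_le_sum fun i hi => ?_)
  rw [one_pow, mul_one]
  exact Nat.le_mul_of_pos_right _ (Nat.choose_pos (Finset.mem_range_succ_iff.1 hi))

/-- An involution of a finite type of even cardinality that fixes a point fixes another one. -/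
lemma Function.Involutive.exists_ne_isFixedPt {V : Type*} [Fintype V] {f : V → V}
    (hf : Function.Involutive f) (hV : Even (Fintype.card V)) {a : V} (ha : f a = a) :
    ∃ b, b ≠ a ∧ f b = b := by
  classical
  by_contra! hfix
  have hsum : ∑ _v ∈ Finset.univ.erase a, (1 : ZMod 2) = 0 := by
    refine Finset.sum_involution (fun v _ => f v) (fun _ _ => by decide)
      (fun v hv _ => hfix v (Finset.ne_of_mem_erase hv)) (fun v hv => ?_) (fun v _ => hf v)
    refine Finset.mem_erase.2 ⟨fun h => Finset.ne_of_mem_erase hv ?_, Finset.mem_univ _⟩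
    rw [← hf v, h, ha]
  rw [Finset.sum_const, nsmul_one, ZMod.natCast_eq_zero_iff_even,
    Finset.card_erase_of_mem (Finset.mem_univ a), Finset.card_univ] at hsum
  have : 0 < Fintype.card V := Fintype.card_pos_iff.2 ⟨a⟩
  grind

namespace SimpleGraph

variable {V : Type*}

/-- A matching of `H`, encoded as the involution exchanging matched vertices. -/
def IsMatchingInvolution (H : SimpleGraph V) (f : V → V) : Prop :=
  Function.Involutive f ∧ ∀ v, f v ≠ v → H.Adj v (f v)

section Augment

variable [Fintype V] [DecidableEq V] {H : SimpleGraph V} {f : V → V} {a b y : V}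

/-- Two adjacent unmatched vertices may be added to a matching. -/
lemma IsMatchingInvolution.exists_card_lt_of_adj (hf : H.IsMatchingInvolution f)
    (ha : f a = a) (hb : f b = b) (hab : H.Adj a b) :
    ∃ g, H.IsMatchingInvolution g ∧
      (Finset.univ.filter fun v => g v = v).card < (Finset.univ.filter fun v => f v = v).card := by
  have hne := hab.ne
  refine ⟨fun v => if v = a then b else if v = b then a else f v, ⟨fun v => ?_, fun v => ?_⟩, ?_⟩
  · have := hf.1 v
    have := hf.1 a
    grind
  · have := hf.2 v
    have := hab.symm
    grind
  · refine Finset.card_lt_card (Finset.ssubset_iff_of_subset ?_ |>.2 ⟨a, by simpa, ?_⟩)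
    · intro v
      simp only [Finset.mem_filter, Finset.mem_univ, true_and]
      grind
    · simp [hne.symm]

/-- An augmenting path of length three enlarges a matching. -/
lemma IsMatchingInvolution.exists_card_lt_of_augment (hf : H.IsMatchingInvolution f)
    (hne : a ≠ b) (ha : f a = a) (hb : f b = b) (hy : f y ≠ y)
    (hax : H.Adj a (f y)) (hby : H.Adj b y) :
    ∃ g, H.IsMatchingInvolution g ∧
      (Finset.univ.filter fun v => g v = v).card < (Finset.univ.filter fun v => f v = v).card := by
  have hax' := hax.ne
  have hby' := hby.ne
  have hyy := hf.1 y
  refine ⟨fun v => if v = a then f y else if v = f y then a else if v = b then y else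
    if v = y then b else f v, ⟨fun v => ?_, fun v => ?_⟩, ?_⟩
  · have := hf.1 v
    grind
  · have := hf.2 v
    have := hax.symm
    have := hby.symm
    grind
  · refine Finset.card_lt_card (Finset.ssubset_iff_of_subset ?_ |>.2 ⟨a, by simpa, ?_⟩)
    · intro v
      simp only [Finset.mem_filter, Finset.mem_univ, true_and]
      grind
    · simp [hax'.symm]

end Augment

/-- A graph of even order whose minimum degree is at least half the order has a perfect
matching. -/
lemma exists_involutive_adj_of_card_le_two_mul_degree [Fintype V] (H : SimpleGraph V)
    [DecidableRel H.Adj] (hV : Even (Fintype.card V))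
    (hdeg : ∀ v, Fintype.card V ≤ 2 * H.degree v) :
    ∃ f : V → V, Function.Involutive f ∧ ∀ v, H.Adj v (f v) := by
  classical
  obtain ⟨f, hf, hmin⟩ := exists_minimalFor_of_wellFoundedLT (H.IsMatchingInvolution)
    (fun f => (Finset.univ.filter fun v => f v = v).card) ⟨id, fun _ => rfl, by simp⟩
  replace hmin : ¬ ∃ g, H.IsMatchingInvolution g ∧ (Finset.univ.filter fun v => g v = v).card <
      (Finset.univ.filter fun v => f v = v).card :=
    fun ⟨g, hg, hlt⟩ => hlt.not_ge (hmin hg hlt.le)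
  refine ⟨f, hf.1, fun a => hf.2 a fun ha => hmin ?_⟩
  obtain ⟨b, hba, hb⟩ := hf.1.exists_ne_isFixedPt hV ha
  by_cases hab : H.Adj a b
  · exact hf.exists_card_lt_of_adj ha hb hab
  have hinter : (H.neighborFinset a ∩ (H.neighborFinset b).image f).Nonempty := by
    rw [← Finset.card_pos]
    have hunion : H.neighborFinset a ∪ (H.neighborFinset b).image f ⊆ (Finset.univ.erase a) := by
      intro v hv
      simp only [Finset.mem_union, mem_neighborFinset, Finset.mem_image] at hv
      refine Finset.mem_erase.2 ⟨?_, Finset.mem_univ _⟩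
      rintro rfl
      rcases hv with hv | ⟨w, hw, hwv⟩
      · exact H.irrefl hv
      · have : w = v := by rw [← hf.1 w, hwv, ha]
        exact hab (this ▸ hw.symm)
    have hcard := Finset.card_le_card hunion
    rw [Finset.card_erase_of_mem (Finset.mem_univ a), Finset.card_univ] at hcard
    have hadd := Finset.card_union_add_card_inter (H.neighborFinset a)
      ((H.neighborFinset b).image f)
    rw [Finset.card_image_of_injective _ hf.1.injective, card_neighborFinset_eq_degree,
      card_neighborFinset_eq_degree] at hadd
    have := hdeg a
    have := hdeg b
    have : 0 < Fintype.card V := Fintype.card_pos_iff.2 ⟨a⟩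
    omega
  obtain ⟨x, hx⟩ := hinter
  simp only [Finset.mem_inter, mem_neighborFinset, Finset.mem_image] at hx
  obtain ⟨hax, y, hby, rfl⟩ := hx
  by_cases hy : f y = y
  · exact hf.exists_card_lt_of_adj hb hy hby
  · exact hf.exists_card_lt_of_augment hba.symm ha hb hy hax hby

lemma exists_adj_edist_eq_of_edist_eq_add_one (G : SimpleGraph V) {v u : V} {k : ℕ}
    (h : G.edist v u = (k + 1 : ℕ)) : ∃ w, G.Adj w u ∧ G.edist v w = k := by
  obtain ⟨p, hp⟩ := exists_walk_of_edist_eq_coe h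
  have hnil : ¬ p.Nil := by
    rw [← Walk.length_eq_zero_iff]
    omega
  refine ⟨p.penultimate, p.adj_penultimate hnil, le_antisymm ?_ ?_⟩
  · refine (edist_le p.dropLast).trans ?_
    have := p.length_dropLast_add_one hnil
    exact_mod_cast (by omega : p.dropLast.length ≤ k)
  · have htri := G.edist_triangle (u := v) (v := p.penultimate) (w := u)
    rw [h, edist_eq_one_iff_adj.2 (p.adj_penultimate hnil), Nat.cast_add, Nat.cast_one] at htri
    exact (ENat.add_le_add_iff_right (by simp)).1 htri

section Fintype

variable [Fintype V] (G : SimpleGraph V) [DecidableRel G.Adj]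

open Classical in
/-- The sphere of radius `k + 1` has at most `Δ (Δ - 1) ^ k` vertices. -/
lemma card_filter_edist_eq_add_one_le (v : V) (k : ℕ) :
    (Finset.univ.filter fun u => G.edist v u = (k + 1 : ℕ)).card ≤
      G.maxDegree * (G.maxDegree - 1) ^ k := by
  induction k with
  | zero =>
    rw [pow_zero, mul_one]
    refine le_trans (Finset.card_le_card fun u hu => ?_) (G.degree_le_maxDegree v)
    simpa [edist_eq_one_iff_adj] using hu
  | succ k ih =>
    rw [pow_succ, ← mul_assoc]
    refine le_trans ?_ (Nat.mul_le_mul_right _ ih)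
    refine (Finset.card_le_card (t := (Finset.univ.filter
      fun u => G.edist v u = (k + 1 : ℕ)).biUnion fun w => (G.neighborFinset w).filter
        fun u => G.edist v u = (k + 1 + 1 : ℕ)) fun u hu => ?_).trans
      (Finset.card_biUnion_le_card_mul _ _ _ fun w hw => ?_)
    · simp only [Finset.mem_filter, Finset.mem_univ, true_and] at hu
      obtain ⟨w, hwu, hw⟩ := G.exists_adj_edist_eq_of_edist_eq_add_one hu
      simp only [Finset.mem_biUnion, Finset.mem_filter, Finset.mem_univ, true_and,
        mem_neighborFinset]
      exact ⟨w, hw, hwu, hu⟩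
    · simp only [Finset.mem_filter, Finset.mem_univ, true_and] at hw
      obtain ⟨x, hxw, hx⟩ := G.exists_adj_edist_eq_of_edist_eq_add_one hw
      refine Nat.le_sub_one_of_lt (lt_of_lt_of_le (Finset.card_lt_card ?_)
        (G.degree_le_maxDegree w))
      refine (Finset.filter_ssubset).2 ⟨x, by simpa using hxw.symm, ?_⟩
      rw [hx]
      norm_cast
      omega

open Classical in
/-- The closed ball of radius `Δ` has at most `Δ ^ Δ + 1` vertices. -/
lemma card_filter_edist_le_maxDegree (v : V) :
    (Finset.univ.filter fun u => G.edist v u ≤ G.maxDegree).card ≤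
      G.maxDegree ^ G.maxDegree + 1 := by
  have hcover : (Finset.univ.filter fun u => G.edist v u ≤ G.maxDegree) ⊆
      insert v ((Finset.range G.maxDegree).biUnion
        fun k => Finset.univ.filter fun u => G.edist v u = (k + 1 : ℕ)) := by
    intro u hu
    simp only [Finset.mem_filter, Finset.mem_univ, true_and] at hu
    obtain ⟨m, hm, hmd⟩ := ENat.le_natCast_iff.1 hu
    simp only [Finset.mem_insert, Finset.mem_biUnion, Finset.mem_range, Finset.mem_filter,
      Finset.mem_univ, true_and]
    rcases m with _ | m
    · exact .inl (edist_eq_zero_iff (G := G) |>.1 (by rw [hm]; rfl)).symm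
    · exact .inr ⟨m, by omega, hm⟩
  refine (Finset.card_le_card hcover).trans ((Finset.card_insert_le _ _).trans ?_)
  gcongr
  exact Finset.card_biUnion_le.trans ((Finset.sum_le_sum fun k _ =>
    G.card_filter_edist_eq_add_one_le v k).trans (sum_range_pred_pow_le _))

/-- Edge-disjoint paths joining the pairs of an involution use at most all the edges, each of them
being counted at both ends of its path. -/
lemma sum_length_le_two_mul_card_edgeFinset {f : V → V} (P : (v : V) → G.Walk v (f v))
    (hpath : ∀ v, (P v).IsPath)
    (hdisj : ∀ u v, u ≠ v → u ≠ f v → List.Disjoint (P u).edges (P v).edges) :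
    ∑ v, (P v).length ≤ 2 * G.edgeFinset.card := by
  classical
  have hlen (v : V) : (P v).length = (G.edgeFinset.bipartiteAbove
      (fun v e => e ∈ (P v).edges) v).card := by
    rw [← Walk.length_edges, ← List.toFinset_card_of_nodup (hpath v).isTrail.edges_nodup]
    congr 1
    ext e
    simpa [Finset.mem_bipartiteAbove] using fun he => (P v).edges_subset_edgeSet he
  rw [Finset.sum_congr rfl fun v _ => hlen v,
    Finset.sum_card_bipartiteAbove_eq_sum_card_bipartiteBelow, mul_comm]
  refine Finset.sum_le_card_nsmul _ _ _ fun e _ => ?_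
  rcases (Finset.univ.bipartiteBelow (fun v e => e ∈ (P v).edges) e).eq_empty_or_nonempty with
    h | ⟨v, hv⟩
  · simp [h]
  · refine (Finset.card_le_card (t := {v, f v}) fun u hu => ?_).trans Finset.card_le_two
    simp only [Finset.mem_bipartiteBelow, Finset.mem_univ, true_and] at hu hv
    by_contra hne
    simp only [Finset.mem_insert, Finset.mem_singleton, not_or] at hne
    exact hdisj u v hne.1 hne.2 hu hv

end Fintype

end SimpleGraph

/-- If `G` is a path-pairable simple graph on `n` vertices with maximum degree `Δ`, then
`n ≤ 2 * Δ ^ Δ`. -/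
theorem statement_3 (V : Type) [Fintype V] (G : SimpleGraph V) [DecidableRel G.Adj]
    (h : IsPathPairable G) :
    Fintype.card V ≤ 2 * G.maxDegree ^ G.maxDegree := by
  classical
  obtain ⟨hV, hpair⟩ := h
  by_contra! hcard
  let H : SimpleGraph V :=
    { Adj := fun u v => (G.maxDegree : ℕ∞) < G.edist u v
      symm := ⟨fun u v huv => by rwa [edist_comm]⟩
      loopless := ⟨fun v hv => by simp at hv⟩ }
  have hdeg (v : V) : Fintype.card V ≤ 2 * H.degree v := by
    have hball := G.card_filter_edist_le_maxDegree v
    have hsplit := Finset.card_filter_add_card_filter_not (s := (Finset.univ : Finset V))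
      (fun u => G.edist v u ≤ G.maxDegree)
    have hfar : (Finset.univ.filter fun u => ¬ G.edist v u ≤ G.maxDegree) =
        H.neighborFinset v := by
      ext u
      simp [H]
    rw [hfar, card_neighborFinset_eq_degree, Finset.card_univ] at hsplit
    grind
  obtain ⟨f, hf, hfar⟩ := H.exists_involutive_adj_of_card_le_two_mul_degree hV hdeg
  obtain ⟨P, hpath, hdisj⟩ := hpair f hf fun v => (hfar v).ne'
  have hlower : Fintype.card V * (G.maxDegree + 1) ≤ ∑ v, (P v).length := by
    refine Finset.card_nsmul_le_sum (Finset.univ : Finset V) (fun v => (P v).length) _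
      fun v _ => ?_
    exact_mod_cast Order.add_one_le_of_lt ((hfar v).trans_le (edist_le (P v)))
  have hupper : 2 * G.edgeFinset.card ≤ Fintype.card V * G.maxDegree := by
    rw [← sum_degrees_eq_twice_card_edges]
    exact Finset.sum_le_card_nsmul (Finset.univ : Finset V) _ _ fun v _ =>
      G.degree_le_maxDegree v
  have := G.sum_length_le_two_mul_card_edgeFinset P hpath hdisj
  rw [mul_add_one] at hlower
  omega
end

section
/- There exists a constant c_1 > 0 such that every path-pairable simple graph on n vertices, with n ≥ 4 even, has maximum degree at least c_1 · (log n)/(log log n). -/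
open SimpleGraph

/-- `G.Within k v w` means that some walk of length at most `k` joins `v` to `w`. -/
def SimpleGraph.Within {V : Type*} (G : SimpleGraph V) (k : ℕ) (v w : V) : Prop :=
  ∃ p : G.Walk v w, p.length ≤ k

theorem SimpleGraph.Within.symm {V : Type*} {G : SimpleGraph V} {k : ℕ} {v w : V}
    (h : G.Within k v w) : G.Within k w v := by
  obtain ⟨p, hp⟩ := h
  exact ⟨p.reverse, by simpa using hp⟩

theorem SimpleGraph.Within.refl {V : Type*} (G : SimpleGraph V) (k : ℕ) (v : V) :
    G.Within k v v := ⟨Walk.nil, by simp⟩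

open Classical in
theorem SimpleGraph.card_within_le {V : Type*} [Fintype V] (G : SimpleGraph V)
    [DecidableRel G.Adj] (k : ℕ) (v : V) :
    (Finset.univ.filter (G.Within k v)).card ≤ (G.maxDegree + 1) ^ k := by
  induction k generalizing v with
  | zero =>
    rw [pow_zero, Finset.card_le_one]
    have h : ∀ w, G.Within 0 v w → v = w := fun w ⟨p, hp⟩ =>
      Walk.eq_of_length_eq_zero (Nat.le_zero.1 hp)
    intro a ha b hb
    rw [← h a (Finset.mem_filter.1 ha).2, ← h b (Finset.mem_filter.1 hb).2]
  | succ k ih =>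
    have hsub : Finset.univ.filter (G.Within (k + 1) v) ⊆
        (insert v (G.neighborFinset v)).biUnion fun x => Finset.univ.filter (G.Within k x) := by
      intro w hw
      obtain ⟨p, hp⟩ := (Finset.mem_filter.1 hw).2
      simp only [Finset.mem_biUnion, Finset.mem_filter, Finset.mem_univ, true_and,
        Finset.mem_insert, mem_neighborFinset]
      cases p with
      | nil => exact ⟨v, Or.inl rfl, Within.refl G k v⟩
      | cons h q => exact ⟨_, Or.inr h, q, by simpa using hp⟩
    calc _ ≤ _ := Finset.card_le_card hsub
      _ ≤ (insert v (G.neighborFinset v)).card * (G.maxDegree + 1) ^ k :=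
        Finset.card_biUnion_le_card_mul _ _ _ fun x _ => ih x
      _ ≤ (G.maxDegree + 1) * (G.maxDegree + 1) ^ k := by
        gcongr
        refine (Finset.card_insert_le _ _).trans ?_
        rw [card_neighborFinset_eq_degree]
        exact Nat.succ_le_succ (G.degree_le_maxDegree v)
      _ = _ := by ring

theorem exists_involutive_forall_ne {V : Type*} [Fintype V] (h : Even (Fintype.card V)) :
    ∃ f : V → V, Function.Involutive f ∧ ∀ v, f v ≠ v := by
  obtain ⟨k, hk⟩ := h
  have e : V ≃ Fin k × Bool := Fintype.equivOfCardEq (by simp [hk]; ring)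
  refine ⟨fun v => e.symm ((e v).1, !(e v).2), fun v => by simp, fun v hv => ?_⟩
  have := congrArg (fun x => (e x).2) hv
  simp at this

open Classical in
/-- If every vertex is related to at most `B` vertices, then some perfect pairing has at most `B`
vertices related to their partners. -/
theorem exists_involutive_card_le {V : Type*} [Fintype V] (h : Even (Fintype.card V))
    (r : V → V → Prop) (hrefl : ∀ v, r v v) (hsymm : ∀ v w, r v w → r w v) (B : ℕ)
    (hB : ∀ v, (Finset.univ.filter (r v)).card ≤ B) :
    ∃ f : V → V, Function.Involutive f ∧ (∀ v, f v ≠ v) ∧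
      (Finset.univ.filter fun v => r v (f v)).card ≤ B := by
  by_contra! hcon
  suffices H : ∀ m : ℕ, ∀ f : V → V, Function.Involutive f → (∀ v, f v ≠ v) →
      (Finset.univ.filter fun v => r v (f v)).card = m → False by
    obtain ⟨f, hf, hne⟩ := exists_involutive_forall_ne h
    exact H _ f hf hne rfl
  intro m
  induction m using Nat.strong_induction_on with
  | _ m ih =>
  intro f hf hne hm
  set C := Finset.univ.filter fun v => r v (f v) with hC
  have hBC : B < C.card := hcon f hf hne
  obtain ⟨v, hv⟩ : C.Nonempty := Finset.card_pos.1 (by omega)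
  obtain ⟨u, hu, huv⟩ : ∃ u ∈ C, u ∉ Finset.univ.filter (r v) :=
    Finset.exists_mem_notMem_of_card_lt_card ((hB v).trans_lt hBC)
  have hrv : r v (f v) := (Finset.mem_filter.1 hv).2
  have hru : r u (f u) := (Finset.mem_filter.1 hu).2
  have hvu : ¬ r v u := fun h => huv (by simp [h])
  have hne_vu : v ≠ u := fun h => hvu (h ▸ hrefl v)
  have hne_fvu : f v ≠ u := fun h => hvu (h ▸ hrv)
  let σ := Equiv.swap (f v) u
  have hσσ : ∀ x, σ (σ x) = x := Equiv.swap_apply_self _ _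
  refine ih _ ?_ (fun x => σ (f (σ x))) (fun x => by simp [hσσ, hf _])
    (fun x hx => hne (σ x) (by rw [← hσσ (f (σ x)), hx])) rfl
  rw [← hm]
  refine Finset.card_lt_card (Finset.ssubset_iff_subset_ne.2 ⟨?_, fun heq => ?_⟩)
  · intro x hx
    have hx := (Finset.mem_filter.1 hx).2
    refine Finset.mem_filter.2 ⟨Finset.mem_univ _, ?_⟩
    by_cases h1 : x = f v
    · rw [h1, hf v]; exact hsymm _ _ hrv
    by_cases h2 : x = u
    · rw [h2]; exact hru
    by_cases h3 : x = v
    · rw [h3]; exact hrv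
    by_cases h4 : x = f u
    · rw [h4, hf u]; exact hsymm _ _ hru
    have e1 : σ x = x := Equiv.swap_apply_of_ne_of_ne h1 h2
    have e2 : σ (f x) = f x := Equiv.swap_apply_of_ne_of_ne
      (fun h => h3 (hf.injective h)) (fun h => h4 (by rw [← h, hf x]))
    simpa only [e1, e2] using hx
  · have hv' := hv
    rw [← heq] at hv'
    have hx := (Finset.mem_filter.1 hv').2
    have e1 : σ v = v := Equiv.swap_apply_of_ne_of_ne (hne v).symm hne_vu
    have e2 : σ (f v) = u := Equiv.swap_apply_left _ _
    simp only [e1, e2] at hx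
    exact hvu hx

open Classical in
/-- Edge-disjoint walks realising a pairing use each edge for at most one pair. -/
theorem sum_length_le_of_edge_disjoint {V : Type*} [Fintype V] (G : SimpleGraph V)
    [DecidableRel G.Adj] (f : V → V) (P : (v : V) → G.Walk v (f v))
    (hP : ∀ v, (P v).IsPath)
    (hdisj : ∀ u v : V, u ≠ v → u ≠ f v → List.Disjoint (P u).edges (P v).edges) :
    ∑ v, (P v).length ≤ Fintype.card V * G.maxDegree := by
  have hlen : ∀ v, (P v).length = ∑ e ∈ G.edgeFinset, if e ∈ (P v).edges then 1 else 0 := by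
    intro v
    rw [← Finset.card_filter, ← Walk.length_edges,
      ← List.toFinset_card_of_nodup (hP v).isTrail.edges_nodup]
    congr 1
    ext e
    simp only [List.mem_toFinset, Finset.mem_filter, mem_edgeFinset]
    exact ⟨fun h => ⟨(P v).edges_subset_edgeSet h, h⟩, fun h => h.2⟩
  calc ∑ v, (P v).length = ∑ e ∈ G.edgeFinset, ∑ v, if e ∈ (P v).edges then 1 else 0 := by
        rw [Finset.sum_comm]; exact Finset.sum_congr rfl fun v _ => hlen v
    _ ≤ ∑ e ∈ G.edgeFinset, 2 := by
        refine Finset.sum_le_sum fun e _ => ?_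
        rw [← Finset.card_filter]
        rcases Finset.eq_empty_or_nonempty (Finset.univ.filter fun v => e ∈ (P v).edges)
          with h | ⟨v, hv⟩
        · simp [h]
        · refine (Finset.card_le_card (t := {v, f v}) fun u hu => ?_).trans Finset.card_le_two
          by_contra hcon
          simp only [Finset.mem_insert, Finset.mem_singleton, not_or] at hcon
          exact hdisj u v hcon.1 hcon.2 (Finset.mem_filter.1 hu).2 (Finset.mem_filter.1 hv).2
    _ = ∑ v, G.degree v := by
        rw [G.sum_degrees_eq_twice_card_edges, Finset.sum_const, smul_eq_mul, mul_comm]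
    _ ≤ ∑ _v : V, G.maxDegree := Finset.sum_le_sum fun v _ => G.degree_le_maxDegree v
    _ = _ := by simp

theorem IsPathPairable.card_lt {V : Type*} [Fintype V] {G : SimpleGraph V} [DecidableRel G.Adj]
    (hG : IsPathPairable G) (hpos : 0 < Fintype.card V) :
    Fintype.card V < 2 * (G.maxDegree + 1) ^ (2 * G.maxDegree) := by
  classical
  by_contra! hcon
  set D := G.maxDegree
  set n := Fintype.card V
  obtain ⟨f, hf, hne, hcard⟩ := exists_involutive_card_le hG.1 (G.Within (2 * D))
    (Within.refl G _) (fun _ _ h => h.symm) (B := (D + 1) ^ (2 * D)) (G.card_within_le (2 * D))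
  obtain ⟨P, hP, hdisj⟩ := hG.2 f hf hne
  have hsum := sum_length_le_of_edge_disjoint G f P hP hdisj
  have hfar : (Finset.univ.filter fun v => ¬ G.Within (2 * D) v (f v)).card * (2 * D + 1) ≤
      ∑ v, (P v).length := by
    rw [← smul_eq_mul]
    refine (Finset.card_nsmul_le_sum _ (fun v => (P v).length) _ fun v hv => ?_).trans
      (Finset.sum_le_sum_of_subset (Finset.subset_univ _))
    by_contra! hlt
    exact (Finset.mem_filter.1 hv).2 ⟨P v, by omega⟩
  have hsplit := Finset.card_filter_add_card_filter_not (s := (Finset.univ : Finset V))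
    (fun v => G.Within (2 * D) v (f v))
  rw [Finset.card_univ] at hsplit
  have hhalf : n ≤ 2 * (Finset.univ.filter fun v => ¬ G.Within (2 * D) v (f v)).card := by omega
  nlinarith

theorem log_div_log_log_le {n D : ℕ} (hn : 4 ≤ n) (h : n < 2 * (D + 1) ^ (2 * D)) :
    1 / 8 * (Real.log n / Real.log (Real.log n)) ≤ (D : ℝ) := by
  have hD : 1 ≤ D := by
    by_contra! h0
    obtain rfl : D = 0 := by omega
    simp at h
    omega
  have hD' : (1 : ℝ) ≤ D := by exact_mod_cast hD
  have hpow : n ≤ (2 * D) ^ (3 * D) := calc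
    n ≤ 2 * (D + 1) ^ (2 * D) := h.le
    _ ≤ (2 * D) ^ D * (2 * D) ^ (2 * D) := by
      gcongr
      · calc 2 ≤ 2 * D := by omega
          _ ≤ (2 * D) ^ D := Nat.le_self_pow (by omega) _
      · omega
    _ = (2 * D) ^ (3 * D) := by rw [← pow_add]; congr 1; ring
  have hlog : Real.log n ≤ 3 * D * Real.log (2 * D) := by
    have h1 : (n : ℝ) ≤ (2 * D) ^ (3 * D) := by exact_mod_cast hpow
    have h2 := Real.log_le_log (by positivity) h1
    rw [Real.log_pow] at h2
    exact_mod_cast h2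
  have hL : 1.38 ≤ Real.log n := by
    have h1 : Real.log 4 ≤ Real.log n := Real.log_le_log (by norm_num) (by exact_mod_cast hn)
    have h2 : Real.log 4 = 2 * Real.log 2 := by
      rw [show (4 : ℝ) = 2 ^ 2 by norm_num, Real.log_pow]; norm_num
    linarith [Real.log_two_gt_d9]
  set L := Real.log n
  have hll : 1 / 4 ≤ Real.log L := by
    have h1 := Real.one_sub_inv_le_log_of_pos (show 0 < L by linarith)
    have h2 : L⁻¹ ≤ 1.38⁻¹ := by gcongr
    norm_num at h2
    linarith
  rw [← mul_div_assoc, div_le_iff₀ (by linarith)]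
  rcases le_total (2 * (D : ℝ)) L with hc | hc
  · have h1 : Real.log (2 * D) ≤ Real.log L := Real.log_le_log (by linarith) hc
    nlinarith
  · nlinarith

/-- There exists `c₁ > 0` such that every path-pairable simple graph on `n ≥ 4` vertices
(`n` even) has maximum degree at least `c₁ * log n / log log n`. -/
theorem statement_4 :
    ∃ c₁ : ℝ, 0 < c₁ ∧
      ∀ (V : Type) [Fintype V] (G : SimpleGraph V) [DecidableRel G.Adj],
        4 ≤ Fintype.card V → Even (Fintype.card V) → IsPathPairable G →
          c₁ * (Real.log (Fintype.card V) / Real.log (Real.log (Fintype.card V))) ≤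
            (G.maxDegree : ℝ) := by
  exact ⟨1 / 8, by norm_num,
    fun V _ G _ hn _ hG => log_div_log_log_le hn (hG.card_lt (by omega))⟩
end

section
/- Let k be a natural number and let ε_1, ε_2 be positive reals with ε_1 + ε_2 ≤ 2^(−k). Then there exists M_0 = M_0(k) such that every simple graph G with exactly M ≥ M_0 edges satisfies at least one of the following: (1) some edge of G is incident with (i.e., at distance 0 from) at least ε_1·M edges of G; (2) at least ε_2·(M choose 2) unordered pairs of edges of G are at distance greater than 1; (3) G contains a good k-matching. -/
/-- The distance between two edges `e` and `f` of a graph: the minimum, over endpoints `u` of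
`e` and endpoints `v` of `f`, of the graph distance between `u` and `v` (with value `⊤` if no
such pair is joined by a walk).  Two edges at distance `0` are called *incident*. -/
noncomputable def edgeDist {V : Type*} (G : SimpleGraph V) (e f : Sym2 V) : ℕ∞ :=
  ⨅ (u : V) (_ : u ∈ e) (v : V) (_ : v ∈ f), G.edist u v

/-- A *good `k`-matching* in `G` is a set of `k` pairwise disjoint edges of `G` such that any
two of its edges are at distance exactly `1`. -/
def IsGoodMatching {V : Type*} (G : SimpleGraph V) (k : ℕ) (M : Finset (Sym2 V)) : Prop :=
  M.card = k ∧ (∀ e ∈ M, e ∈ G.edgeSet) ∧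
    (∀ e ∈ M, ∀ f ∈ M, e ≠ f → ∀ v : V, ¬(v ∈ e ∧ v ∈ f)) ∧
      ∀ e ∈ M, ∀ f ∈ M, e ≠ f → edgeDist G e f = 1

attribute [local instance] Classical.propDecidable

open Finset in
/-- Turán's bound on the number of edges, in division-free form. -/
theorem SimpleGraph.CliqueFree.two_mul_card_edgeFinset_le {W : Type*} [Fintype W]
    {H : SimpleGraph W} [DecidableRel H.Adj] {r : ℕ} (hr : 0 < r) (hH : H.CliqueFree (r + 1)) :
    2 * r * #H.edgeFinset ≤ (r - 1) * Fintype.card W ^ 2 := by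
  classical
  obtain ⟨K, _, hK⟩ := exists_isTuranMaximal (V := W) hr
  have h : #H.edgeFinset ≤ #(turanGraph (Fintype.card W) r).edgeFinset := by
    rw [← ((isTuranMaximal_iff_nonempty_iso_turanGraph hr).1 hK).some.card_edgeFinset_eq]
    exact hK.2 hH
  exact (Nat.mul_le_mul_left _ h).trans mul_card_edgeFinset_turanGraph_le

theorem edgeDist_comm {V : Type*} (G : SimpleGraph V) (e f : Sym2 V) :
    edgeDist G e f = edgeDist G f e := by
  have key : ∀ e f, edgeDist G e f ≤ edgeDist G f e := fun e f =>
    le_iInf₂ fun u hu => le_iInf₂ fun v hv =>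
      (iInf₂_le_of_le v hv (iInf₂_le_of_le u hu le_rfl)).trans_eq SimpleGraph.edist_comm
  exact le_antisymm (key e f) (key f e)

theorem edgeDist_eq_zero_of_mem {V : Type*} (G : SimpleGraph V) {e f : Sym2 V} {v : V}
    (he : v ∈ e) (hf : v ∈ f) : edgeDist G e f = 0 :=
  le_antisymm ((iInf₂_le_of_le v he (iInf₂_le_of_le v hf le_rfl)).trans_eq
    SimpleGraph.edist_self) zero_le

theorem edgeDist_self {V : Type*} (G : SimpleGraph V) (e : Sym2 V) : edgeDist G e e = 0 :=
  edgeDist_eq_zero_of_mem G e.out_fst_mem e.out_fst_mem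

/-- The graph on the edges of `G` joining distinct edges whose distance satisfies `P`. -/
def edgeDistGraph {V : Type*} (G : SimpleGraph V) (P : ℕ∞ → Prop) : SimpleGraph G.edgeSet where
  Adj e f := e ≠ f ∧ P (edgeDist G e f)
  symm := ⟨fun e f h => ⟨h.1.symm, edgeDist_comm G e f ▸ h.2⟩⟩
  loopless := ⟨fun _ h => h.1 rfl⟩

@[simp]
theorem edgeDistGraph_adj {V : Type*} {G : SimpleGraph V} {P : ℕ∞ → Prop} {e f : G.edgeSet} :
    (edgeDistGraph G P).Adj e f ↔ e ≠ f ∧ P (edgeDist G e f) :=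
  Iff.rfl

/-- The image of a clique in the distance-one graph is a good matching. -/
theorem isGoodMatching_map_of_isNClique {V : Type*} {G : SimpleGraph V} {k : ℕ}
    {s : Finset G.edgeSet} (hs : (edgeDistGraph G (· = 1)).IsNClique k s) :
    IsGoodMatching G k (s.map (Function.Embedding.subtype _)) := by
  have key : ∀ e ∈ s.map (Function.Embedding.subtype _),
      ∀ f ∈ s.map (Function.Embedding.subtype _), e ≠ f → edgeDist G e f = 1 := by
    intro e he f hf hef
    obtain ⟨e, hes, rfl⟩ := Finset.mem_map.1 he
    obtain ⟨f, hfs, rfl⟩ := Finset.mem_map.1 hf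
    exact (hs.isClique hes hfs fun h => hef (congrArg _ h)).2
  refine ⟨by rw [Finset.card_map, hs.card_eq], ?_, fun e he f hf hef v hv => ?_, key⟩
  · intro e he
    obtain ⟨e, -, rfl⟩ := Finset.mem_map.1 he
    exact e.2
  · have h := key e he f hf hef
    rw [edgeDist_eq_zero_of_mem G hv.1 hv.2] at h
    exact zero_ne_one h

section Counting

open Finset

variable {V : Type*} [Fintype V] [DecidableEq V] (G : SimpleGraph V) [DecidableRel G.Adj]

theorem choose_two_le_card_edgeFinset_edgeDistGraph :
    (#G.edgeFinset).choose 2 ≤ #(edgeDistGraph G (· = 1)).edgeFinset +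
      #(edgeDistGraph G (· = 0)).edgeFinset + #(edgeDistGraph G (1 < ·)).edgeFinset := by
  rw [SimpleGraph.edgeFinset_card, ← SimpleGraph.card_edgeFinset_top_eq_card_choose_two]
  refine (card_le_card fun p hp => ?_).trans ((card_union_le _ _).trans
    (Nat.add_le_add_right (card_union_le _ _) _))
  induction p with | _ e f
  have hef : e ≠ f := by simpa using hp
  simp only [mem_union, SimpleGraph.mem_edgeFinset, SimpleGraph.mem_edgeSet,
    edgeDistGraph_adj]
  rcases lt_trichotomy (edgeDist G e f) 1 with h | h | h
  · exact Or.inl (Or.inr ⟨hef, Order.lt_one_iff.1 h⟩)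
  · exact Or.inl (Or.inl ⟨hef, h⟩)
  · exact Or.inr ⟨hef, h⟩

theorem degree_edgeDistGraph_le (e : G.edgeSet) :
    (edgeDistGraph G (· = 0)).degree e ≤
      #{f ∈ G.edgeFinset | f ≠ (e : Sym2 V) ∧ edgeDist G e f = 0} := by
  rw [← SimpleGraph.card_neighborFinset_eq_degree]
  refine card_le_card_of_injOn Subtype.val (fun f hf => ?_) Subtype.val_injective.injOn
  have hf' : e ≠ f ∧ edgeDist G e f = 0 := by
    simpa using hf
  simpa using ⟨fun h => hf'.1 (Subtype.ext h.symm), hf'.2⟩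

theorem card_edgeFinset_edgeDistGraph_le :
    #(edgeDistGraph G (1 < ·)).edgeFinset ≤
      #{p ∈ G.edgeFinset.sym2 | ∀ e f : Sym2 V, p = s(e, f) → 1 < edgeDist G e f} := by
  refine card_le_card_of_injOn (Sym2.map Subtype.val) (fun p hp => ?_)
    (Sym2.map.injective Subtype.val_injective).injOn
  induction p with | _ e f
  have hef : e ≠ f ∧ 1 < edgeDist G e f := by
    simpa using hp
  refine mem_coe.2 (mem_filter.2 ⟨?_, fun e' f' h => ?_⟩)
  · simp
  · rw [Sym2.map_mk, Sym2.eq_iff] at h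
    obtain ⟨rfl, rfl⟩ | ⟨rfl, rfl⟩ := h
    · exact hef.2
    · exact edgeDist_comm G e f ▸ hef.2

end Counting

/-- For every natural number `k` there is an `M₀ = M₀(k)` such that for all positive reals
`ε₁, ε₂` with `ε₁ + ε₂ ≤ 2⁻ᵏ`, every simple graph with `M ≥ M₀` edges satisfies one of:
(1) some edge is incident with (at distance `0` from) at least `ε₁ * M` other edges;
(2) at least `ε₂ * (M choose 2)` unordered pairs of edges are at distance greater than `1`;
(3) the graph contains a good `k`-matching. -/
theorem statement_6 (k : ℕ) :
    ∃ M₀ : ℕ, ∀ ε₁ ε₂ : ℝ, 0 < ε₁ → 0 < ε₂ → ε₁ + ε₂ ≤ (2 : ℝ) ^ (-(k : ℤ)) →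
      ∀ (V : Type) [Fintype V] [DecidableEq V] (G : SimpleGraph V) [DecidableRel G.Adj],
        M₀ ≤ G.edgeFinset.card →
          (∃ e ∈ G.edgeFinset,
              ε₁ * (G.edgeFinset.card : ℝ) ≤
                ((G.edgeFinset.filter fun f => f ≠ e ∧ edgeDist G e f = 0).card : ℝ)) ∨
            (ε₂ * ((G.edgeFinset.card).choose 2 : ℝ) ≤
              ((G.edgeFinset.sym2.filter fun p =>
                  ∀ e f : Sym2 V, p = s(e, f) → 1 < edgeDist G e f).card : ℝ)) ∨
              ∃ M : Finset (Sym2 V), IsGoodMatching G k M := by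
  refine ⟨2 * k + 1, fun ε₁ ε₂ h₁ h₂ hε V _ _ G _ hM => ?_⟩
  by_contra! hcon
  obtain ⟨hinc, hfar, hgood⟩ := hcon
  have hfree : (edgeDistGraph G (· = 1)).CliqueFree k := fun s hs =>
    hgood _ (isGoodMatching_map_of_isNClique hs)
  obtain _ | _ | r := k
  · exact SimpleGraph.not_cliqueFree_zero hfree
  · obtain ⟨e, he⟩ := Finset.card_pos.1 (show 0 < G.edgeFinset.card by omega)
    exact (SimpleGraph.cliqueFree_one.1 hfree).false ⟨e, SimpleGraph.mem_edgeFinset.1 he⟩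
  have hturan := hfree.two_mul_card_edgeFinset_le r.succ_pos
  have hpairs := choose_two_le_card_edgeFinset_edgeDistGraph G
  have hfar' : ((edgeDistGraph G (1 < ·)).edgeFinset.card : ℝ) ≤
      ε₂ * (G.edgeFinset.card.choose 2 : ℝ) :=
    (Nat.cast_le.2 (card_edgeFinset_edgeDistGraph_le G)).trans hfar.le
  have hinc' : (2 : ℝ) * (edgeDistGraph G (· = 0)).edgeFinset.card ≤
      G.edgeFinset.card * (ε₁ * G.edgeFinset.card) := by
    have hdeg : ∀ e ∈ Finset.univ, ((edgeDistGraph G (· = 0)).degree e : ℝ) ≤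
        ε₁ * G.edgeFinset.card := fun e _ =>
      (Nat.cast_le.2 (degree_edgeDistGraph_le G e)).trans
        (hinc e (SimpleGraph.mem_edgeFinset.2 e.2)).le
    have hsum := Finset.sum_le_card_nsmul _ _ _ hdeg
    rw [← Nat.cast_sum, SimpleGraph.sum_degrees_eq_twice_card_edges, Finset.card_univ,
      ← SimpleGraph.edgeFinset_card, nsmul_eq_mul] at hsum
    exact_mod_cast hsum
  rw [← SimpleGraph.edgeFinset_card] at hturan
  have hpairs' : (G.edgeFinset.card.choose 2 : ℝ) ≤ (edgeDistGraph G (· = 1)).edgeFinset.card +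
      (edgeDistGraph G (· = 0)).edgeFinset.card + (edgeDistGraph G (1 < ·)).edgeFinset.card :=
    mod_cast hpairs
  have hturan' : 2 * ((r : ℝ) + 1) * (edgeDistGraph G (· = 1)).edgeFinset.card ≤
      r * (G.edgeFinset.card : ℝ) ^ 2 := mod_cast hturan
  have hM' : 2 * ((r : ℝ) + 2) + 1 ≤ G.edgeFinset.card := mod_cast hM
  have hr : ((r : ℝ) + 1) * (ε₁ + ε₂) ≤ 1 / 2 := by
    have hpow : (r : ℝ) + 1 ≤ 2 ^ (r + 1) := mod_cast (r + 1).lt_two_pow_self.le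
    calc ((r : ℝ) + 1) * (ε₁ + ε₂) ≤ 2 ^ (r + 1) * (2 : ℝ) ^ (-((r + 1 + 1 : ℕ) : ℤ)) := by
          gcongr
      _ = 1 / 2 := by
          rw [zpow_neg, zpow_natCast, pow_succ _ (r + 1)]
          field_simp
  rw [Nat.cast_choose_two] at hpairs' hfar'
  generalize (G.edgeFinset.card : ℝ) = m at *
  generalize ((edgeDistGraph G (· = 1)).edgeFinset.card : ℝ) = a at *
  generalize ((edgeDistGraph G (· = 0)).edgeFinset.card : ℝ) = b at *
  generalize ((edgeDistGraph G (1 < ·)).edgeFinset.card : ℝ) = c at *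
  have hx : (0 : ℝ) ≤ r := r.cast_nonneg
  generalize (r : ℝ) = x at *
  have hm : 0 < m := by linarith
  have h2a : m * (m - 1) - (ε₁ + ε₂) * m ^ 2 ≤ 2 * a := by nlinarith [mul_pos h₂ hm]
  have hxa := mul_le_mul_of_nonneg_left h2a (by linarith : 0 ≤ x + 1)
  have hrm := mul_le_mul_of_nonneg_right hr (sq_nonneg m)
  have hlt : m * (2 * (x + 1)) < m * m := by gcongr; linarith
  linarith
end

section
/- Let D be a positive integer and let ε be a real number with 0 < ε ≤ 1/2. Then there exists c > 0 such that the following holds. Let G be a path-pairable planar simple graph on n vertices with maximum degree Δ(G) ≤ c·n, and let U ⊆ A ⊆ V(G) be sets such that every vertex of A has degree at most D in G, |A| ≥ (1−ε)n, and |U| ≥ ε·n; set B = V(G) \ A. Then there is a partition of U (omitting one vertex of U if |U| is odd) into unordered pairs such that every family of pairwise edge-disjoint paths in G joining the two vertices of each pair uses, in total, at least 2|U| − 16ε·n edges having one endpoint in A and the other in B. -/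
open SimpleGraph

attribute [local instance] Classical.propDecidable

namespace PathPairable

open Finset

section Minor

variable {V : Type*}

/-- The set of ordered adjacent pairs of `G` inside `S`. -/
noncomputable def adjPairs (G : SimpleGraph V) (S : Finset V) : Finset (V × V) :=
  (S ×ˢ S).filter fun p => G.Adj p.1 p.2

/-- `G` has a complete minor on `r` vertices all of whose branch sets lie inside `S`. -/
def HasCliqueMinorIn (G : SimpleGraph V) (S : Finset V) (r : ℕ) : Prop :=
  ∃ B : Fin r → Set V,
    (∀ i, B i ⊆ S) ∧ (∀ i, (B i).Nonempty) ∧ (∀ i j, i ≠ j → Disjoint (B i) (B j)) ∧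
      (∀ i, (G.induce (B i)).Connected) ∧
        ∀ i j, i ≠ j → ∃ a ∈ B i, ∃ b ∈ B j, G.Adj a b

/-- The graph obtained from `G` by joining `u` to all neighbours of `v`; deleting `v` from it
yields the contraction of the edge `uv`. -/
def absorb (G : SimpleGraph V) (u v : V) : SimpleGraph V where
  Adj x y := x ≠ y ∧ (G.Adj x y ∨ (x = u ∧ G.Adj v y) ∨ (y = u ∧ G.Adj v x))
  symm := ⟨by
    rintro x y ⟨h, h'⟩
    refine ⟨h.symm, ?_⟩
    rcases h' with h' | h' | h'
    · exact Or.inl h'.symm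
    · exact Or.inr (Or.inr h')
    · exact Or.inr (Or.inl h')⟩
  loopless := ⟨fun x h => h.1 rfl⟩

lemma reachable_of_adj_reachable {α β : Type*} {H : SimpleGraph α} {K : SimpleGraph β}
    (f : α → β) (h : ∀ x y, H.Adj x y → K.Reachable (f x) (f y)) {x y : α}
    (hxy : H.Reachable x y) : K.Reachable (f x) (f y) := by
  obtain ⟨w⟩ := hxy
  induction w with
  | nil => exact Reachable.refl _
  | cons hadj _ ih => exact (h _ _ hadj).trans ih

lemma HasCliqueMinorIn.of_absorb {G : SimpleGraph V} {S : Finset V} {u v : V} {r : ℕ}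
    (hv : v ∈ S) (huv : G.Adj u v) (h : HasCliqueMinorIn (absorb G u v) (S.erase v) r) :
    HasCliqueMinorIn G S r := by
  obtain ⟨B, hBS, hne, hdisj, hconn, hadj⟩ := h
  have hvB : ∀ i, v ∉ B i := fun i hi => by simpa using hBS i hi
  let B' : Fin r → Set V := fun i => {x | x ∈ B i ∨ (x = v ∧ u ∈ B i)}
  have hsub : ∀ i, B i ⊆ B' i := fun i x hx => Or.inl hx
  refine ⟨B', ?_, fun i => (hne i).mono (hsub i), ?_, ?_, ?_⟩
  · rintro i x (hx | ⟨rfl, -⟩)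
    · exact Finset.mem_of_mem_erase (hBS i hx)
    · exact hv
  · intro i j hij
    have hd := Set.disjoint_left.1 (hdisj i j hij)
    rw [Set.disjoint_left]
    rintro x (hx | ⟨rfl, hx⟩) (hy | ⟨hy', hy⟩)
    · exact hd hx hy
    · exact hvB i (hy' ▸ hx)
    · exact hvB j hy
    · exact hd hx hy
  · intro i
    have hstep : ∀ x y : B i, ((absorb G u v).induce (B i)).Adj x y →
        (G.induce (B' i)).Reachable ⟨x, hsub i x.2⟩ ⟨y, hsub i y.2⟩ := by
      rintro ⟨x, hx⟩ ⟨y, hy⟩ ⟨-, h | ⟨h1, h2⟩ | ⟨h1, h2⟩⟩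
      · exact SimpleGraph.Adj.reachable (by simpa using h)
      · change x = u at h1
        change G.Adj v y at h2
        subst h1
        have hv' : v ∈ B' i := Or.inr ⟨rfl, hx⟩
        have e1 : (G.induce (B' i)).Adj ⟨x, hsub i hx⟩ ⟨v, hv'⟩ := by simpa using huv
        have e2 : (G.induce (B' i)).Adj ⟨v, hv'⟩ ⟨y, hsub i hy⟩ := by simpa using h2
        exact e1.reachable.trans e2.reachable
      · change y = u at h1
        change G.Adj v x at h2
        subst h1
        have hv' : v ∈ B' i := Or.inr ⟨rfl, hy⟩
        have e1 : (G.induce (B' i)).Adj ⟨x, hsub i hx⟩ ⟨v, hv'⟩ := by simpa using h2.symm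
        have e2 : (G.induce (B' i)).Adj ⟨v, hv'⟩ ⟨y, hsub i hy⟩ := by simpa using huv.symm
        exact e1.reachable.trans e2.reachable
    have hold : ∀ x y : B i,
        (G.induce (B' i)).Reachable ⟨x, hsub i x.2⟩ ⟨y, hsub i y.2⟩ := fun x y =>
      reachable_of_adj_reachable (fun x : B i => (⟨x, hsub i x.2⟩ : B' i)) hstep
        ((hconn i).preconnected x y)
    obtain ⟨a, ha⟩ := hne i
    rw [connected_iff_exists_forall_reachable]
    refine ⟨⟨a, hsub i ha⟩, ?_⟩
    rintro ⟨x, hx | ⟨rfl, hx⟩⟩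
    · exact hold ⟨a, ha⟩ ⟨x, hx⟩
    · refine (hold ⟨a, ha⟩ ⟨u, hx⟩).trans (SimpleGraph.Adj.reachable ?_)
      simpa using huv
  · intro i j hij
    obtain ⟨a, ha, b, hb, -, h | ⟨rfl, h⟩ | ⟨rfl, h⟩⟩ := hadj i j hij
    · exact ⟨a, hsub i ha, b, hsub j hb, h⟩
    · exact ⟨v, Or.inr ⟨rfl, ha⟩, b, hsub j hb, h⟩
    · exact ⟨a, hsub i ha, v, Or.inr ⟨rfl, hb⟩, h.symm⟩

lemma mem_adjPairs {G : SimpleGraph V} {S : Finset V} {x y : V} :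
    (x, y) ∈ adjPairs G S ↔ (x ∈ S ∧ y ∈ S) ∧ G.Adj x y := by
  simp [adjPairs]

lemma card_adjPairs_eq_sum (G : SimpleGraph V) (S : Finset V) :
    #(adjPairs G S) = ∑ x ∈ S, #(S.filter (G.Adj x)) := by
  rw [adjPairs, card_filter, sum_product]
  exact sum_congr rfl fun x _ => (card_filter _ _).symm

lemma card_adjPairs_erase (G : SimpleGraph V) {S : Finset V} {v : V} (hv : v ∈ S) :
    #(adjPairs G S) = #(adjPairs G (S.erase v)) + 2 * #(S.filter (G.Adj v)) := by
  have hsplit : ∀ x, #(S.filter (G.Adj x)) =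
      (if G.Adj x v then 1 else 0) + #((S.erase v).filter (G.Adj x)) := by
    intro x
    rw [card_filter, card_filter, ← add_sum_erase _ _ hv]
  rw [card_adjPairs_eq_sum, card_adjPairs_eq_sum, ← add_sum_erase _ _ hv]
  have h1 : ∑ x ∈ S.erase v, #(S.filter (G.Adj x)) =
      #(S.filter (G.Adj v)) + ∑ x ∈ S.erase v, #((S.erase v).filter (G.Adj x)) := by
    rw [sum_congr rfl fun x _ => hsplit x, sum_add_distrib, ← card_filter]
    congr 2
    ext x
    simp only [mem_filter, mem_erase]
    constructor
    · rintro ⟨⟨_, h⟩, h'⟩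
      exact ⟨h, h'.symm⟩
    · rintro ⟨h, h'⟩
      exact ⟨⟨h'.ne', h⟩, h'.symm⟩
  rw [h1]
  ring

lemma card_adjPairs_absorb (G : SimpleGraph V) {S : Finset V} {u v : V} (hu : u ∈ S)
    (huv : G.Adj u v) :
    #(adjPairs G (S.erase v)) + 2 * #(S.filter (G.Adj v)) ≤
      #(adjPairs (absorb G u v) (S.erase v)) +
        2 * (#(S.filter fun x => G.Adj v x ∧ G.Adj u x) + 1) := by
  set M := S.filter fun x => G.Adj v x ∧ ¬ G.Adj u x ∧ x ≠ u with hM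
  have hdeg : #(S.filter (G.Adj v)) ≤ #M + (#(S.filter fun x => G.Adj v x ∧ G.Adj u x) + 1) := by
    have : S.filter (G.Adj v) ⊆ M ∪ ((S.filter fun x => G.Adj v x ∧ G.Adj u x) ∪ {u}) := by
      intro x
      simp only [hM, mem_filter, mem_union, mem_singleton]
      tauto
    refine (card_le_card this).trans ((card_union_le _ _).trans ?_)
    gcongr
    exact (card_union_le _ _).trans (by simp)
  have hsub : adjPairs G (S.erase v) ∪ (M.image (fun x => (u, x)) ∪ M.image (fun x => (x, u))) ⊆
      adjPairs (absorb G u v) (S.erase v) := by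
    rintro ⟨x, y⟩
    simp only [mem_adjPairs, absorb, hM, mem_union, mem_filter, mem_erase, mem_image,
      Prod.mk.injEq]
    have hne := huv.ne
    rintro (⟨h, h'⟩ | ⟨z, ⟨hz, hvz, -, hzu⟩, rfl, rfl⟩ | ⟨z, ⟨hz, hvz, -, hzu⟩, rfl, rfl⟩)
    · exact ⟨h, h'.ne, Or.inl h'⟩
    · exact ⟨by simp [hne, hu, hz, hvz.ne'], hzu.symm, by simp [hvz]⟩
    · exact ⟨by simp [hne, hu, hz, hvz.ne'], hzu, by simp [hvz]⟩
  have hc := card_le_card hsub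
  rw [card_union_of_disjoint, card_union_of_disjoint, card_image_of_injective,
    card_image_of_injective] at hc
  · omega
  · intro a b h
    simpa using h
  · intro a b h
    simpa using h
  · rw [Finset.disjoint_left]
    rintro ⟨x, y⟩
    simp only [hM, mem_image, mem_filter, Prod.mk.injEq]
    rintro ⟨z, ⟨-, -, -, hz⟩, rfl, rfl⟩ ⟨z', ⟨-, -, -, hz'⟩, rfl, rfl⟩
    exact hz rfl
  · rw [Finset.disjoint_left]
    rintro ⟨x, y⟩
    simp only [mem_adjPairs, hM, mem_union, mem_image, mem_filter, Prod.mk.injEq]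
    rintro ⟨-, h⟩ (⟨z, ⟨-, -, hz, -⟩, rfl, rfl⟩ | ⟨z, ⟨-, -, hz, -⟩, rfl, rfl⟩)
    · exact hz h
    · exact hz h.symm

lemma HasCliqueMinorIn.succ {G : SimpleGraph V} {S : Finset V} {v : V} {r : ℕ} (hv : v ∈ S)
    (h : HasCliqueMinorIn G (S.filter (G.Adj v)) r) : HasCliqueMinorIn G S (r + 1) := by
  obtain ⟨B, hBS, hne, hdisj, hconn, hadj⟩ := h
  have hB : ∀ i, ∀ x ∈ B i, x ∈ S ∧ G.Adj v x := fun i x hx => by simpa using hBS i hx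
  refine ⟨Fin.cons {v} B, ?_, ?_, ?_, ?_, ?_⟩
  · refine Fin.cases ?_ fun i => ?_
    · simpa using hv
    · exact fun x hx => (hB i x hx).1
  · refine Fin.cases ?_ fun i => ?_
    · simp
    · exact hne i
  · refine Fin.cases (Fin.cases ?_ fun j _ => ?_) fun i => Fin.cases (fun _ => ?_) fun j hij => ?_
    · simp
    · simpa using fun h => (hB j v h).2.ne rfl
    · simpa using fun h => (hB i v h).2.ne rfl
    · exact hdisj i j fun h => hij (h ▸ rfl)
  · refine Fin.cases ?_ fun i => ?_
    · rw [connected_iff_exists_forall_reachable]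
      refine ⟨⟨v, rfl⟩, ?_⟩
      rintro ⟨x, hx⟩
      obtain rfl : x = v := hx
      exact Reachable.refl _
    · exact hconn i
  · refine Fin.cases (Fin.cases ?_ fun j _ => ?_) fun i => Fin.cases (fun _ => ?_) fun j hij => ?_
    · simp
    · obtain ⟨x, hx⟩ := hne j
      exact ⟨v, rfl, x, hx, (hB j x hx).2⟩
    · obtain ⟨x, hx⟩ := hne i
      exact ⟨x, hx, v, rfl, (hB i x hx).2.symm⟩
    · exact hadj i j fun h => hij (h ▸ rfl)

/-- A graph of average degree at least `2 ^ r` has a complete minor on `r + 2` vertices. -/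
theorem hasCliqueMinorIn_of_card_adjPairs (r : ℕ) (G : SimpleGraph V) (S : Finset V)
    (hS : S.Nonempty) (h : 2 ^ r * #S ≤ #(adjPairs G S)) : HasCliqueMinorIn G S (r + 2) := by
  induction r generalizing G S with
  | zero =>
    have : (adjPairs G S).Nonempty := by
      rw [← card_pos]
      have := hS.card_pos
      omega
    obtain ⟨⟨x, y⟩, hxy⟩ := this
    rw [mem_adjPairs] at hxy
    obtain ⟨⟨hx, hy⟩, hxy⟩ := hxy
    refine HasCliqueMinorIn.succ hx (HasCliqueMinorIn.succ (v := y) (by simp [hy, hxy]) ?_)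
    exact ⟨fun _ => ∅, fun i => i.elim0, fun i => i.elim0, fun i => i.elim0, fun i => i.elim0,
      fun i => i.elim0⟩
  | succ r ih =>
    induction hm : #S generalizing G S with
    | zero => exact absurd hm hS.card_pos.ne'
    | succ m ihm =>
      by_cases hcon : ∃ u ∈ S, ∃ v ∈ S, G.Adj u v ∧
          #(S.filter fun x => G.Adj v x ∧ G.Adj u x) + 1 ≤ 2 ^ r
      · obtain ⟨u, hu, v, hv, huv, ht⟩ := hcon
        refine HasCliqueMinorIn.of_absorb hv huv (ihm _ _ ⟨u, mem_erase.2 ⟨huv.ne, hu⟩⟩ ?_ ?_)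
        · have h1 := card_adjPairs_erase G hv
          have h2 := card_adjPairs_absorb G hu huv
          have h3 := card_erase_add_one hv
          rw [← h3, pow_succ] at h
          rw [pow_succ]
          nlinarith
        · rw [card_erase_of_mem hv, hm]
          rfl
      · push Not at hcon
        have : (adjPairs G S).Nonempty := by
          rw [← card_pos]
          have := hS.card_pos
          exact lt_of_lt_of_le (by positivity) h
        obtain ⟨⟨v, w⟩, hvw⟩ := this
        rw [mem_adjPairs] at hvw
        obtain ⟨⟨hv, hw⟩, hvw⟩ := hvw
        refine HasCliqueMinorIn.succ hv (ih G _ ⟨w, by simp [hw, hvw]⟩ ?_)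
        rw [card_adjPairs_eq_sum, mul_comm, ← smul_eq_mul]
        refine card_nsmul_le_sum _ _ _ fun x hx => ?_
        rw [mem_filter] at hx
        have := hcon x hx.1 v hv hx.2.symm
        rw [filter_filter]
        omega

lemma card_adjPairs_le_of_isPlanar {G : SimpleGraph V} (hG : IsPlanar G) (S : Finset V) :
    #(adjPairs G S) ≤ 8 * #S := by
  by_contra! hlt
  rcases S.eq_empty_or_nonempty with rfl | hS
  · simp [adjPairs] at hlt
  obtain ⟨B, -, hne, hdisj, hconn, hadj⟩ :=
    hasCliqueMinorIn_of_card_adjPairs 3 G S hS (by omega)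
  exact hG.1 ⟨B, hne, hdisj, hconn, fun i j hij => hadj i j hij.ne⟩

end Minor

section Pairing

/-- If every element of `U` conflicts with at most `m` elements, then `U` can be partitioned into
pairs (up to one element) of which at most `m` are conflicting. -/
theorem exists_pairing {V : Type*} (conf : V → V → Prop) (m : ℕ) (U : Finset V)
    (h : ∀ x ∈ U, #(U.filter (conf x)) ≤ m) :
    ∃ pairs : Finset (V × V),
      (∀ p ∈ pairs, p.1 ∈ U ∧ p.2 ∈ U ∧ p.1 ≠ p.2) ∧
      (∀ p ∈ pairs, ∀ q ∈ pairs, p ≠ q →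
        p.1 ≠ q.1 ∧ p.1 ≠ q.2 ∧ p.2 ≠ q.1 ∧ p.2 ≠ q.2) ∧
      #U ≤ 2 * #pairs + 1 ∧ #(pairs.filter fun p => conf p.2 p.1) ≤ m := by
  induction hk : #U using Nat.strong_induction_on generalizing U m with
  | _ k ih =>
  subst hk
  by_cases hU : #U ≤ 1
  · exact ⟨∅, by simp, by simp, by simpa using hU, by simp⟩
  have key : ∀ (x y : V) (m' : ℕ), x ∈ U → y ∈ U → x ≠ y →
      (∀ z ∈ (U.erase x).erase y, #(((U.erase x).erase y).filter (conf z)) ≤ m') →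
      (if conf y x then m' + 1 else m') ≤ m → ∃ pairs : Finset (V × V),
      (∀ p ∈ pairs, p.1 ∈ U ∧ p.2 ∈ U ∧ p.1 ≠ p.2) ∧
      (∀ p ∈ pairs, ∀ q ∈ pairs, p ≠ q →
        p.1 ≠ q.1 ∧ p.1 ≠ q.2 ∧ p.2 ≠ q.1 ∧ p.2 ≠ q.2) ∧
      #U ≤ 2 * #pairs + 1 ∧ #(pairs.filter fun p => conf p.2 p.1) ≤ m := by
    intro x y m' hx hy hxy hz hm
    have hy' : y ∈ U.erase x := mem_erase.2 ⟨hxy.symm, hy⟩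
    have hc1 := card_erase_add_one hx
    have hc2 := card_erase_add_one hy'
    obtain ⟨P, h1, h2, h3, h4⟩ := ih _ (by omega) m' _ hz rfl
    have h1' : ∀ p ∈ P, (p.1 ≠ x ∧ p.1 ≠ y ∧ p.1 ∈ U) ∧ (p.2 ≠ x ∧ p.2 ≠ y ∧ p.2 ∈ U) ∧
        p.1 ≠ p.2 := by
      intro p hp
      have := h1 p hp
      simp only [mem_erase] at this
      tauto
    have hnot : (x, y) ∉ P := fun h => (h1' _ h).1.1 rfl
    refine ⟨insert (x, y) P, ?_, ?_, ?_, ?_⟩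
    · intro p hp
      rcases mem_insert.1 hp with rfl | hp
      · exact ⟨hx, hy, hxy⟩
      · have := h1' p hp
        tauto
    · intro p hp q hq hpq
      rcases mem_insert.1 hp with rfl | hp <;> rcases mem_insert.1 hq with rfl | hq
      · exact absurd rfl hpq
      · have := h1' q hq
        exact ⟨this.1.1.symm, this.2.1.1.symm, this.1.2.1.symm, this.2.1.2.1.symm⟩
      · have := h1' p hp
        exact ⟨this.1.1, this.1.2.1, this.2.1.1, this.2.1.2.1⟩
      · exact h2 p hp q hq hpq
    · rw [card_insert_of_notMem hnot]
      omega
    · rw [filter_insert]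
      split_ifs at hm ⊢ with hxy'
      · exact (card_insert_le _ _).trans (by omega)
      · omega
  by_cases hex : ∃ x ∈ U, ∃ y ∈ U, x ≠ y ∧ ¬ conf x y
  · obtain ⟨x, hx, y, hy, hxy, hc⟩ := hex
    refine key y x m hy hx hxy.symm (fun z hz => ?_) (by simp [hc])
    have hz' : z ∈ U := mem_of_mem_erase (mem_of_mem_erase hz)
    refine (card_le_card (filter_subset_filter _ ?_)).trans (h z hz')
    exact (erase_subset _ _).trans (erase_subset _ _)
  · push Not at hex
    obtain ⟨x, hx, y, hy, hxy⟩ := one_lt_card.1 (not_le.1 hU)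
    have hc := hex x hx y hy hxy
    have hc' := hex y hy x hx hxy.symm
    have hpos : 1 ≤ #(U.filter (conf x)) := card_pos.2 ⟨y, by simp [hy, hc]⟩
    have hm := h x hx
    refine key x y (m - 1) hx hy hxy (fun z hz => ?_) (by simp only [hc', if_true]; omega)
    have hz' : z ∈ U := mem_of_mem_erase (mem_of_mem_erase hz)
    have hzx : z ≠ x := (mem_erase.1 (mem_of_mem_erase hz)).1
    have hlt : #(((U.erase x).erase y).filter (conf z)) < #(U.filter (conf z)) := by
      refine card_lt_card ⟨filter_subset_filter _
        ((erase_subset _ _).trans (erase_subset _ _)), fun hsub => ?_⟩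
      have hx' := hsub (mem_filter.2 ⟨hx, hex z hz' x hx hzx⟩)
      simp at hx'
    have := h z hz'
    omega

end Pairing

section Routes

variable {V : Type*} [Fintype V] (G : SimpleGraph V) (A : Finset V)

/-- The vertices adjacent to some vertex of `X`. -/
noncomputable def nbrs (X : Finset V) : Finset V := X.biUnion fun x => univ.filter (G.Adj x)

/-- `X` together with the vertices of `A` adjacent to some vertex of `X`. -/
noncomputable def stepIn (X : Finset V) : Finset V := X ∪ (A ∩ nbrs G X)

/-- The vertices of `A` from which `y` is reached by at most `L` edges inside `A`, after which one
vertex of arbitrary type may be visited, followed by at most `L` further edges inside `A`. -/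
noncomputable def conflictSet (L : ℕ) (y : V) : Finset V :=
  (stepIn G A)^[L] {y} ∪ (stepIn G A)^[L] (A ∩ nbrs G (nbrs G ((stepIn G A)^[L] {y})))

variable {G A}

lemma mem_nbrs {X : Finset V} {z : V} : z ∈ nbrs G X ↔ ∃ x ∈ X, G.Adj z x := by
  simp [nbrs, G.adj_comm]

lemma card_nbrs_le {X : Finset V} {d : ℕ} (h : ∀ x ∈ X, #(univ.filter (G.Adj x)) ≤ d) :
    #(nbrs G X) ≤ #X * d := card_biUnion_le_card_mul _ _ _ h

lemma stepIn_subset {X : Finset V} (hX : X ⊆ A) : stepIn G A X ⊆ A :=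
  union_subset hX inter_subset_left

lemma iterate_stepIn_subset {X : Finset V} (hX : X ⊆ A) (k : ℕ) : (stepIn G A)^[k] X ⊆ A := by
  induction k with
  | zero => exact hX
  | succ k ih =>
    rw [Function.iterate_succ_apply']
    exact stepIn_subset ih

lemma card_iterate_stepIn_le {X : Finset V} {d : ℕ} (hX : X ⊆ A)
    (h : ∀ x ∈ A, #(univ.filter (G.Adj x)) ≤ d) (k : ℕ) :
    #((stepIn G A)^[k] X) ≤ #X * (d + 1) ^ k := by
  induction k with
  | zero => simp
  | succ k ih =>
    rw [Function.iterate_succ_apply']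
    have h1 := card_nbrs_le (G := G) fun x (hx : x ∈ (stepIn G A)^[k] X) =>
      h x (iterate_stepIn_subset hX k hx)
    calc #(stepIn G A ((stepIn G A)^[k] X))
        ≤ #((stepIn G A)^[k] X) + #(A ∩ nbrs G ((stepIn G A)^[k] X)) := card_union_le _ _
      _ ≤ #((stepIn G A)^[k] X) + #((stepIn G A)^[k] X) * d := by
          gcongr
          exact (card_le_card inter_subset_right).trans h1
      _ = #((stepIn G A)^[k] X) * (d + 1) := by ring
      _ ≤ #X * (d + 1) ^ k * (d + 1) := by gcongr
      _ = #X * (d + 1) ^ (k + 1) := by ring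

lemma iterate_stepIn_mono (X : Finset V) : Monotone fun k => (stepIn G A)^[k] X :=
  monotone_nat_of_le_succ fun k => by
    rw [Function.iterate_succ_apply']
    exact subset_union_left

lemma mem_iterate_stepIn_succ {X : Finset V} {z z' : V} {k : ℕ} (hz : z ∈ A)
    (hadj : G.Adj z z') (h : z' ∈ (stepIn G A)^[k] X) : z ∈ (stepIn G A)^[k + 1] X := by
  rw [Function.iterate_succ_apply']
  exact mem_union_right _ (mem_inter.2 ⟨hz, mem_nbrs.2 ⟨z', h, hadj⟩⟩)

lemma card_conflictSet_le {d Δ L : ℕ} (h : ∀ x ∈ A, #(univ.filter (G.Adj x)) ≤ d)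
    (hΔ : ∀ x, #(univ.filter (G.Adj x)) ≤ Δ) (hpos : 1 ≤ Δ) {y : V} (hy : y ∈ A) :
    #(conflictSet G A L y) ≤ 2 * (d + 1) ^ (2 * L + 1) * Δ := by
  have hyA : {y} ⊆ A := singleton_subset_iff.2 hy
  have h1 : #((stepIn G A)^[L] {y}) ≤ (d + 1) ^ L := by
    simpa using card_iterate_stepIn_le hyA h L
  have h2 := card_nbrs_le (G := G) fun x (hx : x ∈ (stepIn G A)^[L] {y}) =>
    h x (iterate_stepIn_subset hyA L hx)
  have h3 := card_nbrs_le (G := G) (X := nbrs G ((stepIn G A)^[L] {y})) fun x _ => hΔ x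
  have h4 : #(A ∩ nbrs G (nbrs G ((stepIn G A)^[L] {y}))) ≤ (d + 1) ^ L * (d + 1) * Δ := by
    refine (card_le_card inter_subset_right).trans (h3.trans ?_)
    gcongr
    exact h2.trans (by gcongr; omega)
  have h5 := card_iterate_stepIn_le
    (X := A ∩ nbrs G (nbrs G ((stepIn G A)^[L] {y}))) inter_subset_left h L
  have h6 : (d + 1) ^ L ≤ (d + 1) ^ (2 * L + 1) * Δ :=
    (Nat.pow_le_pow_right (by omega) (by omega)).trans (Nat.le_mul_of_pos_right _ hpos)
  calc #(conflictSet G A L y) ≤ _ := card_union_le _ _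
    _ ≤ (d + 1) ^ (2 * L + 1) * Δ + (d + 1) ^ L * (d + 1) * Δ * (d + 1) ^ L := by
        gcongr
        · exact h1.trans h6
        · exact h5.trans (by gcongr)
    _ = _ := by ring

end Routes

section Crossing

variable {V : Type*} (A : Finset V)

/-- The pair `e` has one endpoint in `A` and the other outside `A`. -/
def Crosses (e : Sym2 V) : Prop := ∃ a b : V, e = s(a, b) ∧ a ∈ A ∧ b ∉ A

/-- Both endpoints of `e` lie in `A`. -/
def Inside (e : Sym2 V) : Prop := ∀ v ∈ e, v ∈ A

/-- Both endpoints of `e` lie outside `A`. -/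
def Outside (e : Sym2 V) : Prop := ∀ v ∈ e, v ∉ A

variable {A}

lemma crosses_mk {a b : V} : Crosses A s(a, b) ↔ (a ∈ A ∧ b ∉ A) ∨ (b ∈ A ∧ a ∉ A) := by
  constructor
  · rintro ⟨x, y, h, hx, hy⟩
    rcases Sym2.eq_iff.1 h with ⟨rfl, rfl⟩ | ⟨rfl, rfl⟩
    · exact Or.inl ⟨hx, hy⟩
    · exact Or.inr ⟨hx, hy⟩
  · rintro (⟨h, h'⟩ | ⟨h, h'⟩)
    · exact ⟨a, b, rfl, h, h'⟩
    · exact ⟨b, a, Sym2.eq_swap, h, h'⟩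

lemma inside_mk {a b : V} : Inside A s(a, b) ↔ a ∈ A ∧ b ∈ A := by simp [Inside]

lemma outside_mk {a b : V} : Outside A s(a, b) ↔ a ∉ A ∧ b ∉ A := by simp [Outside]

variable {G : SimpleGraph V}

lemma sum_countP_le {ι : Type*} [Fintype ι] {s t : ι → V} (Q : ∀ i, G.Walk (s i) (t i))
    (hQ : ∀ i, (Q i).IsPath) (hdisj : ∀ i j, i ≠ j → List.Disjoint (Q i).edges (Q j).edges)
    (C : Sym2 V → Prop) (T : Finset (Sym2 V)) (hT : ∀ i, ∀ e ∈ (Q i).edges, C e → e ∈ T) :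
    ∑ i, (Q i).edges.countP (C ·) ≤ #T := by
  have hcard : ∀ i, (Q i).edges.countP (C ·) = #((Q i).edges.toFinset.filter C) := by
    intro i
    rw [List.countP_eq_length_filter, ← List.toFinset_card_of_nodup
      ((hQ i).isTrail.edges_nodup.filter _), List.toFinset_filter]
    simp
  rw [sum_congr rfl fun i _ => hcard i, ← card_biUnion]
  · refine card_le_card fun e he => ?_
    simp only [mem_biUnion, mem_univ, true_and, mem_filter, List.mem_toFinset] at he
    obtain ⟨i, hi, hC⟩ := he
    exact hT i e hi hC
  · intro i _ j _ hij
    rw [Function.onFun, Finset.disjoint_left]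
    intro e he he'
    simp only [mem_filter, List.mem_toFinset] at he he'
    exact hdisj i j hij he.1 he'.1

variable [Fintype V]

lemma walk_route {L : ℕ} {y z : V} (w : G.Walk z y) (hy : y ∈ A)
    (hL : w.edges.countP (Inside A ·) ≤ L) :
    (z ∈ A →
      Even (w.edges.countP (Crosses A ·) + 2 * w.edges.countP (Outside A ·)) ∧
      (w.edges.countP (Crosses A ·) + 2 * w.edges.countP (Outside A ·) = 0 →
        z ∈ (stepIn G A)^[w.edges.countP (Inside A ·)] {y}) ∧
      (w.edges.countP (Crosses A ·) + 2 * w.edges.countP (Outside A ·) = 2 →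
        z ∈ (stepIn G A)^[w.edges.countP (Inside A ·)]
          (A ∩ nbrs G (nbrs G ((stepIn G A)^[L] {y}))))) ∧
    (z ∉ A →
      Odd (w.edges.countP (Crosses A ·) + 2 * w.edges.countP (Outside A ·)) ∧
      (w.edges.countP (Crosses A ·) + 2 * w.edges.countP (Outside A ·) = 1 →
        z ∈ nbrs G ((stepIn G A)^[L] {y}))) := by
  induction w with
  | nil => simp [hy]
  | @cons z z' y hadj w ih =>
    simp only [Walk.edges_cons, List.countP_cons, crosses_mk, inside_mk, outside_mk,
      decide_eq_true_eq] at hL ⊢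
    have ih := ih hy (by omega)
    set f := w.edges.countP (Crosses A ·)
    set g := w.edges.countP (Outside A ·)
    set k := w.edges.countP (Inside A ·)
    by_cases hz : z ∈ A <;> by_cases hz' : z' ∈ A <;>
      simp only [hz, hz', not_true_eq_false, not_false_eq_true, and_true, and_false,
        true_and, or_false, or_true, if_true, if_false, add_zero, forall_true_left,
        false_imp_iff] at hL ih ⊢
    · obtain ⟨h1, h2, h3⟩ := ih
      exact ⟨h1, fun h => mem_iterate_stepIn_succ hz hadj (h2 h),
        fun h => mem_iterate_stepIn_succ hz hadj (h3 h)⟩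
    · obtain ⟨h1, h2⟩ := ih
      refine ⟨?_, fun h => by omega, fun h => ?_⟩
      · rw [Nat.even_iff]
        rw [Nat.odd_iff] at h1
        omega
      · refine iterate_stepIn_mono _ (Nat.zero_le _) ?_
        exact mem_inter.2 ⟨hz, mem_nbrs.2 ⟨z', h2 (by omega), hadj⟩⟩
    · obtain ⟨h1, h2, -⟩ := ih
      refine ⟨?_, fun h => ?_⟩
      · rw [Nat.odd_iff]
        rw [Nat.even_iff] at h1
        omega
      · exact mem_nbrs.2 ⟨z', iterate_stepIn_mono _ hL (h2 (by omega)), hadj⟩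
    · obtain ⟨h1, -⟩ := ih
      refine ⟨?_, fun h => by omega⟩
      rw [Nat.odd_iff] at h1 ⊢
      omega

/-- A walk between vertices of `A` that are not in conflict either crosses between `A` and its
complement four times, or uses an edge outside `A`, or uses many edges inside `A`. -/
lemma four_mul_le_of_notMem_conflictSet {L : ℕ} {x y : V} (w : G.Walk x y) (hx : x ∈ A)
    (hy : y ∈ A) (h : x ∉ conflictSet G A L y) :
    4 * L ≤ L * (w.edges.countP (Crosses A ·) + 2 * w.edges.countP (Outside A ·)) +
      4 * w.edges.countP (Inside A ·) := by
  by_contra! hlt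
  have hL : w.edges.countP (Inside A ·) ≤ L := by
    by_contra! hL
    have := Nat.zero_le
      (L * (w.edges.countP (Crosses A ·) + 2 * w.edges.countP (Outside A ·)))
    omega
  obtain ⟨h1, h2, h3⟩ := (walk_route w hy hL).1 hx
  have hf : w.edges.countP (Crosses A ·) + 2 * w.edges.countP (Outside A ·) < 4 := by
    by_contra! hf
    nlinarith
  rw [Nat.even_iff] at h1
  refine h ?_
  obtain h0 | h0 : w.edges.countP (Crosses A ·) + 2 * w.edges.countP (Outside A ·) = 0 ∨
      w.edges.countP (Crosses A ·) + 2 * w.edges.countP (Outside A ·) = 2 := by omega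
  · exact mem_union_left _ (iterate_stepIn_mono _ hL (h2 h0))
  · exact mem_union_right _ (iterate_stepIn_mono _ hL (h3 h0))

lemma card_outside_edges_le (hG : IsPlanar G) :
    2 * #(univ.filter fun e => e ∈ G.edgeSet ∧ Outside A e) ≤ 8 * #Aᶜ := by
  let H : SimpleGraph V := G ⊓ SimpleGraph.fromRel fun a b => a ∉ A ∧ b ∉ A
  have hH : ∀ a b, H.Adj a b ↔ G.Adj a b ∧ a ∉ A ∧ b ∉ A := by
    intro a b
    simp only [H, SimpleGraph.inf_adj, SimpleGraph.fromRel_adj]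
    constructor
    · tauto
    · exact fun h => ⟨h.1, h.1.ne, Or.inl h.2⟩
  have h1 : (univ.filter fun e => e ∈ G.edgeSet ∧ Outside A e) = H.edgeFinset := by
    ext e
    induction e with
    | _ a b => simp [outside_mk, hH]
  have h2 : ∑ v, H.degree v = #(adjPairs G Aᶜ) := by
    rw [card_adjPairs_eq_sum, ← sum_subset (subset_univ Aᶜ)]
    · refine sum_congr rfl fun x hx => ?_
      rw [← card_neighborFinset_eq_degree]
      congr 1
      ext z
      simp only [mem_neighborFinset, hH, mem_filter, mem_compl] at hx ⊢
      tauto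
    · intro x _ hx
      rw [← card_neighborFinset_eq_degree, card_eq_zero]
      ext z
      simp only [mem_neighborFinset, hH, mem_compl, not_not, notMem_empty, iff_false] at hx ⊢
      tauto
  have h3 := H.sum_degrees_eq_twice_card_edges
  rw [h1]
  rw [h2] at h3
  convert card_adjPairs_le_of_isPlanar hG Aᶜ using 1
  rw [h3]
  congr!

lemma card_inside_edges_le {d : ℕ} (h : ∀ x ∈ A, #(univ.filter (G.Adj x)) ≤ d) :
    #(univ.filter fun e => e ∈ G.edgeSet ∧ Inside A e) ≤ #A * d := by
  have hsub : (univ.filter fun e => e ∈ G.edgeSet ∧ Inside A e) ⊆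
      A.biUnion fun x => (univ.filter (G.Adj x)).image fun z => s(x, z) := by
    intro e
    induction e with
    | _ a b =>
      simp only [mem_filter, mem_univ, true_and, mem_edgeSet, inside_mk, mem_biUnion, mem_image]
      rintro ⟨hab, ha, -⟩
      exact ⟨a, ha, b, hab, rfl⟩
  refine (card_le_card hsub).trans (card_biUnion_le_card_mul _ _ _ fun x hx => ?_)
  exact card_image_le.trans (h x hx)

/-- At most `m` conflicting pairs are lost, each edge outside `A` costs two crossings and each edge
inside `A` costs `4 / L`. -/
theorem card_pairs_mul_le {d L m : ℕ} (hG : IsPlanar G)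
    (hd : ∀ x ∈ A, #(univ.filter (G.Adj x)) ≤ d) (pairs : Finset (V × V))
    (hA : ∀ p ∈ pairs, p.1 ∈ A ∧ p.2 ∈ A)
    (hm : #(pairs.filter fun p => p.1 ∈ conflictSet G A L p.2) ≤ m)
    (Q : (p : {p : V × V // p ∈ pairs}) → G.Walk p.val.1 p.val.2)
    (hQ : ∀ p, (Q p).IsPath) (hdisj : ∀ p q, p ≠ q → List.Disjoint (Q p).edges (Q q).edges)
    (T : Finset (Sym2 V)) (hT : ∀ p, ∀ e ∈ (Q p).edges, Crosses A e → e ∈ T) :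
    4 * L * #pairs ≤ L * #T + L * (8 * #Aᶜ) + 4 * (#A * d) + 4 * L * m := by
  have hedge : ∀ p, ∀ e ∈ (Q p).edges, e ∈ G.edgeSet := fun p e he =>
    Walk.edges_subset_edgeSet _ he
  have hc := sum_countP_le Q hQ hdisj (Crosses A) T hT
  have ho := sum_countP_le Q hQ hdisj (Outside A)
    (univ.filter fun e => e ∈ G.edgeSet ∧ Outside A e)
    fun p e he hC => by simpa using ⟨hedge p e he, hC⟩
  have hi := sum_countP_le Q hQ hdisj (Inside A)
    (univ.filter fun e => e ∈ G.edgeSet ∧ Inside A e)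
    fun p e he hC => by simpa using ⟨hedge p e he, hC⟩
  have ho' := card_outside_edges_le (A := A) hG
  have hi' := card_inside_edges_le hd
  have hpt : ∀ p : {p : V × V // p ∈ pairs}, 4 * L ≤
      L * (Q p).edges.countP (Crosses A ·) + 2 * L * (Q p).edges.countP (Outside A ·) +
        4 * (Q p).edges.countP (Inside A ·) +
        (4 * L) * (if p.1.1 ∈ conflictSet G A L p.1.2 then 1 else 0) := by
    intro p
    split_ifs with hp
    · omega
    · have := four_mul_le_of_notMem_conflictSet (Q p) (hA p p.2).1 (hA p p.2).2 hp
      linarith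
  have hsum := sum_le_sum fun p (_ : p ∈ (univ : Finset {p : V × V // p ∈ pairs})) => hpt p
  simp only [sum_add_distrib, ← mul_sum, sum_const, card_univ, Fintype.card_coe,
    smul_eq_mul] at hsum
  have hbad : ∑ p : {p : V × V // p ∈ pairs},
      (if p.1.1 ∈ conflictSet G A L p.1.2 then 1 else 0) ≤ m := by
    rw [card_filter, ← sum_coe_sort] at hm
    exact hm
  calc 4 * L * #pairs = 4 * (#pairs * L) := by ring
    _ ≤ L * ∑ p, (Q p).edges.countP (Crosses A ·) +
        2 * L * ∑ p, (Q p).edges.countP (Outside A ·) +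
        4 * ∑ p, (Q p).edges.countP (Inside A ·) +
        4 * L * ∑ p : {p : V × V // p ∈ pairs},
          (if p.1.1 ∈ conflictSet G A L p.1.2 then 1 else 0) := hsum
    _ ≤ L * #T +
        2 * L * #(univ.filter fun e => e ∈ G.edgeSet ∧ Outside A e) +
        4 * #(univ.filter fun e => e ∈ G.edgeSet ∧ Inside A e) + 4 * L * m := by gcongr
    _ = L * #T +
        L * (2 * #(univ.filter fun e => e ∈ G.edgeSet ∧ Outside A e)) +
        4 * #(univ.filter fun e => e ∈ G.edgeSet ∧ Inside A e) + 4 * L * m := by ring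
    _ ≤ _ := by gcongr

/-- `U` has a near-perfect pairing such that edge-disjoint paths joining the pairs contain many
edges between `A` and its complement. -/
theorem exists_pairing_card_crossing {d L Δ : ℕ} (hG : IsPlanar G)
    (hd : ∀ x ∈ A, #(univ.filter (G.Adj x)) ≤ d) (hΔ : ∀ x, #(univ.filter (G.Adj x)) ≤ Δ)
    (hpos : 1 ≤ Δ) {U : Finset V} (hU : U ⊆ A) :
    ∃ pairs : Finset (V × V),
      (∀ p ∈ pairs, p.1 ∈ U ∧ p.2 ∈ U ∧ p.1 ≠ p.2) ∧
      (∀ p ∈ pairs, ∀ q ∈ pairs, p ≠ q →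
        p.1 ≠ q.1 ∧ p.1 ≠ q.2 ∧ p.2 ≠ q.1 ∧ p.2 ≠ q.2) ∧
      #U ≤ 2 * #pairs + 1 ∧
      ∀ Q : (p : {p : V × V // p ∈ pairs}) → G.Walk p.val.1 p.val.2,
        (∀ p, (Q p).IsPath) →
        (∀ p q, p ≠ q → List.Disjoint (Q p).edges (Q q).edges) →
        ∀ T : Finset (Sym2 V), (∀ p, ∀ e ∈ (Q p).edges, Crosses A e → e ∈ T) →
          4 * L * #pairs ≤ L * #T + L * (8 * (Fintype.card V - #A)) + 4 * (#A * d) +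
            4 * L * (2 * (d + 1) ^ (2 * L + 1) * Δ) := by
  have hconf : ∀ y ∈ U, #(U.filter (fun x => x ∈ conflictSet G A L y)) ≤
      2 * (d + 1) ^ (2 * L + 1) * Δ := fun y hy =>
    (card_le_card fun x hx => (mem_filter.1 hx).2).trans (card_conflictSet_le hd hΔ hpos (hU hy))
  obtain ⟨pairs, h1, h2, h3, h4⟩ := exists_pairing
    (fun y x => x ∈ conflictSet G A L y) _ U (by convert hconf)
  refine ⟨pairs, h1, h2, h3, fun Q hQ hdisj T hT => ?_⟩
  rw [← card_compl]
  exact card_pairs_mul_le hG hd pairs (fun p hp => ⟨hU (h1 p hp).1, hU (h1 p hp).2.1⟩)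
    (by convert h4) Q hQ hdisj T hT

end Crossing

lemma exists_adj_of_isPathPairable {V : Type*} [Fintype V] [Nonempty V] {G : SimpleGraph V}
    (hG : IsPathPairable G) : ∃ a b, G.Adj a b := by
  obtain ⟨⟨k, hk⟩, h⟩ := hG
  have hk0 : 0 < k := by
    have := Fintype.card_pos (α := V)
    omega
  let e : V ≃ Fin k ⊕ Fin k := Fintype.equivOfCardEq (by simp [hk])
  have hswap : ∀ s : Fin k ⊕ Fin k, s.swap ≠ s := by rintro (s | s) <;> simp
  obtain ⟨P, -, -⟩ := h (fun v => e.symm (e v).swap) (fun v => by simp)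
    (fun v hv => hswap (e v) (by simpa using congrArg e hv))
  obtain ⟨v⟩ := ‹Nonempty V›
  have hne : e.symm (e v).swap ≠ v := fun hv => hswap (e v) (by simpa using congrArg e hv)
  have hnil : ¬ (P v).Nil := fun h => hne h.eq.symm
  exact ⟨v, _, (P v).adj_snd hnil⟩

end PathPairable

/-- Let `D` be a positive integer and `0 < ε ≤ 1/2`.  Then there exists `c > 0` such that:
if `G` is a path-pairable planar simple graph on `n` vertices with `Δ(G) ≤ c * n`, and
`U ⊆ A ⊆ V(G)` with every vertex of `A` of degree at most `D`, `|A| ≥ (1 - ε) * n` and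
`|U| ≥ ε * n`, then there is a partition of `U` (omitting one vertex when `|U|` is odd)
into unordered pairs such that every family of pairwise edge-disjoint paths joining the two
vertices of each pair uses in total at least `2|U| - 16εn` edges with one endpoint in `A`
and the other in `B = V(G) \ A`. -/
theorem statement_10 (D : ℕ) (hD : 0 < D) (ε : ℝ) (hε : 0 < ε) (hε' : ε ≤ 1 / 2) :
    ∃ c : ℝ, 0 < c ∧
      ∀ (V : Type) [Fintype V] [DecidableEq V] (G : SimpleGraph V) [DecidableRel G.Adj]
        (A U : Finset V),
        IsPathPairable G → IsPlanar G →
        (G.maxDegree : ℝ) ≤ c * (Fintype.card V : ℝ) →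
        U ⊆ A →
        (∀ v ∈ A, G.degree v ≤ D) →
        (1 - ε) * (Fintype.card V : ℝ) ≤ (A.card : ℝ) →
        ε * (Fintype.card V : ℝ) ≤ (U.card : ℝ) →
        ∃ pairs : Finset (V × V),
          (∀ p ∈ pairs, p.1 ∈ U ∧ p.2 ∈ U ∧ p.1 ≠ p.2) ∧
          (∀ p ∈ pairs, ∀ q ∈ pairs, p ≠ q →
            p.1 ≠ q.1 ∧ p.1 ≠ q.2 ∧ p.2 ≠ q.1 ∧ p.2 ≠ q.2) ∧
          U.card ≤ 2 * pairs.card + 1 ∧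
          ∀ Q : (p : {p : V × V // p ∈ pairs}) → G.Walk p.val.1 p.val.2,
            (∀ p, (Q p).IsPath) →
            (∀ p q, p ≠ q → List.Disjoint (Q p).edges (Q q).edges) →
            2 * (U.card : ℝ) - 16 * ε * (Fintype.card V : ℝ) ≤
              ((Finset.univ.filter fun e : Sym2 V =>
                  (∃ p, e ∈ (Q p).edges) ∧
                    ∃ a b : V, e = s(a, b) ∧ a ∈ A ∧ b ∉ A).card : ℝ) := by
  obtain ⟨L, hL⟩ := exists_nat_gt (4 * D / ε)
  have hDr : (0 : ℝ) < D := by exact_mod_cast hD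
  have hLpos : (0 : ℝ) < L := lt_trans (by positivity) hL
  have hLD : 4 * (D : ℝ) ≤ ε * L := by
    rw [div_lt_iff₀ hε] at hL
    linarith
  set K : ℝ := 2 * ((D : ℝ) + 1) ^ (2 * L + 1) with hK
  have hK2 : 2 ≤ K := by
    have : (1 : ℝ) ≤ ((D : ℝ) + 1) ^ (2 * L + 1) := one_le_pow₀ (by linarith)
    linarith
  refine ⟨ε / K, by positivity, ?_⟩
  intro V _ _ G _ A U hpp hpl hmax hUA hdeg hA hU
  rcases isEmpty_or_nonempty V with hV | hV
  · refine ⟨∅, by simp, by simp, by simp [Finset.eq_empty_of_isEmpty U], ?_⟩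
    intro Q _ _
    simp [Finset.eq_empty_of_isEmpty U]
  obtain ⟨a, b, hab⟩ := PathPairable.exists_adj_of_isPathPairable hpp
  set n : ℝ := (Fintype.card V : ℝ) with hn
  have hΔ : ∀ x, (Finset.univ.filter (G.Adj x)).card ≤ G.maxDegree := by
    intro x
    rw [← G.neighborFinset_eq_filter]
    exact G.degree_le_maxDegree x
  have hd : ∀ x ∈ A, (Finset.univ.filter (G.Adj x)).card ≤ D := by
    intro x hx
    rw [← G.neighborFinset_eq_filter]
    exact hdeg x hx
  have hpos : 1 ≤ G.maxDegree :=
    le_trans (Finset.card_pos.2 ⟨b, by simpa using hab⟩) (hΔ a)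
  have hKm : K * (G.maxDegree : ℝ) ≤ ε * n := by
    rw [div_mul_eq_mul_div, le_div_iff₀ (by positivity)] at hmax
    linarith
  have hεn : 2 ≤ ε * n := by
    have : (1 : ℝ) ≤ G.maxDegree := by exact_mod_cast hpos
    nlinarith
  set m := 2 * (D + 1) ^ (2 * L + 1) * G.maxDegree with hm
  have hmn : (m : ℝ) ≤ ε * n := by
    rw [hm]
    push_cast
    exact hKm
  obtain ⟨pairs, h1, h2, h3, h4⟩ := PathPairable.exists_pairing_card_crossing (L := L) hpl
    (by convert hd) (by convert hΔ) hpos hUA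
  refine ⟨pairs, h1, h2, h3, fun Q hQ hdisj => ?_⟩
  suffices hbound : ∀ T : Finset (Sym2 V),
      (∀ p, ∀ e ∈ (Q p).edges, PathPairable.Crosses A e → e ∈ T) →
      2 * (U.card : ℝ) - 16 * ε * n ≤ (T.card : ℝ) by
    refine hbound _ fun p e he hC => ?_
    rw [Finset.mem_filter]
    exact ⟨Finset.mem_univ e, ⟨p, he⟩, hC⟩
  intro T hT
  have key := h4 Q hQ hdisj T hT
  rw [← hm] at key
  have hAn : A.card ≤ Fintype.card V := Finset.card_le_univ A
  have keyR : 4 * (L : ℝ) * pairs.card ≤ L * T.card + L * (8 * (n - A.card)) +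
      4 * (A.card * D) + 4 * L * m := by
    have := (Nat.cast_le (α := ℝ)).2 key
    push_cast [Nat.cast_sub hAn] at this
    exact this
  have hAn' : (A.card : ℝ) ≤ n := Nat.cast_le.2 hAn
  have hUc : (U.card : ℝ) ≤ 2 * pairs.card + 1 := by exact_mod_cast h3
  have hinside : 4 * ((A.card : ℝ) * D) ≤ L * (ε * n) := by
    have h5 : (A.card : ℝ) * (4 * D) ≤ n * (ε * L) := by gcongr
    linarith
  have hdiv : 4 * (pairs.card : ℝ) ≤ T.card + 8 * (n - A.card) + ε * n + 4 * m := by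
    refine le_of_mul_le_mul_left ?_ hLpos
    linarith
  linarith
end

section
/- For all positive integers m and n with m + n even, m ≠ 2 and n ≠ 2, the complete bipartite graph K_{m,n} is path-pairable. -/
open SimpleGraph

theorem exists_ne_ne_of_card_ne_two {α : Type*} [Fintype α] (h : Fintype.card α ≠ 2) {a b : α}
    (hab : a ≠ b) : ∃ c, c ≠ a ∧ c ≠ b := by
  classical
  by_contra! hc
  refine h ?_
  rw [← Finset.card_univ, ← Finset.card_pair hab]
  congr 1
  ext x
  have := hc x
  grind

/-- A choice of midpoints for the pairs lying inside one part of `α ⊕ β`: it sends each such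
vertex to the opposite part, and no two pairs in opposite parts use a common edge. -/
theorem exists_midpoints {α β : Type*} [Fintype α] [Fintype β] [Nonempty α] [Nonempty β]
    (hα : Fintype.card α ≠ 2) (hβ : Fintype.card β ≠ 2)
    (f : α ⊕ β → α ⊕ β) (hf : Function.Involutive f) (hne : ∀ v, f v ≠ v) :
    ∃ mid : α ⊕ β → α ⊕ β,
      (∀ v, (mid v).isLeft = !v.isLeft) ∧
        ∀ x y, x.isLeft = true → (f x).isLeft = true → y.isLeft = false → (f y).isLeft = false →
          (mid x = y ∨ mid x = f y) → mid y ≠ x ∧ mid y ≠ f x := by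
  classical
  by_cases hc : ∃ v, v.isLeft = true ∧ (f v).isLeft = false
  · obtain ⟨v, hv, hfv⟩ := hc
    refine ⟨fun u => if u.isLeft then f v else v, ?_, ?_⟩
    · intro u
      cases h : u.isLeft <;> simp only [h] <;> simp_all
    · intro x y hx hfx hy hfy h
      have := hf v
      have := hf y
      grind
  · push Not at hc
    have hl : ∀ v, v.isLeft = true → (f v).isLeft = true := by
      intro v hv
      simpa using hc v hv
    have hr : ∀ v, v.isLeft = false → (f v).isLeft = false := by
      intro v hv
      by_contra h
      have := hl (f v) (by simpa using h)
      rw [hf v] at this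
      simp [hv] at this
    obtain ⟨a⟩ := ‹Nonempty α›
    obtain ⟨b⟩ := ‹Nonempty β›
    obtain ⟨a', ha'⟩ := Sum.isLeft_iff.mp (hl (.inl a) rfl)
    obtain ⟨b', hb'⟩ := Sum.isRight_iff.mp (by simpa using hr (.inr b) rfl)
    obtain ⟨c, hca, hca'⟩ := exists_ne_ne_of_card_ne_two hα (a := a) (b := a')
      fun h => hne (.inl a) (by rw [ha', h])
    obtain ⟨d, hdb, hdb'⟩ := exists_ne_ne_of_card_ne_two hβ (a := b) (b := b')
      fun h => hne (.inr b) (by rw [hb', h])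
    have hfa' : f (.inl a') = .inl a := by rw [← ha', hf]
    have hfb' : f (.inr b') = .inr b := by rw [← hb', hf]
    refine ⟨Sum.elim (fun x => if x = a ∨ x = a' then .inr b else .inr d)
      (fun y => if y = b ∨ y = b' then .inl c else .inl a), ?_, ?_⟩
    · rintro (x | y)
      · by_cases h : x = a ∨ x = a' <;> simp [h]
      · by_cases h : y = b ∨ y = b' <;> simp [h]
    · rintro (x | x) (y | y) hx hfx hy hfy h <;> try simp at hx hy
      have := hf (.inl x)
      have := hf (.inr y)
      simp only [Sum.elim_inl, Sum.elim_inr] at h ⊢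
      grind

theorem exists_walk_through_midpoint {α β : Type*} {u v w : α ⊕ β} (huv : u ≠ v)
    (hw : w.isLeft = !u.isLeft) :
    ∃ p : (completeBipartiteGraph α β).Walk u v, p.IsPath ∧
      ∀ e ∈ p.edges, (u.isLeft ≠ v.isLeft ∧ e = s(u, v)) ∨
        (u.isLeft = v.isLeft ∧ (e = s(u, w) ∨ e = s(v, w))) := by
  by_cases h : u.isLeft = v.isLeft
  · have huw : (completeBipartiteGraph α β).Adj u w := by
      rcases u with u | u <;> rcases w with w | w <;> simp_all
    have hwv : (completeBipartiteGraph α β).Adj w v := by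
      rcases v with v | v <;> rcases w with w | w <;> simp_all
    refine ⟨.cons huw (.cons hwv .nil), ?_, ?_⟩
    · simp [huv, huw.ne, hwv.ne]
    · intro e he
      right
      simpa [h, Sym2.eq_swap (a := v)] using he
  · have huv' : (completeBipartiteGraph α β).Adj u v := by
      rcases u with u | u <;> rcases v with v | v <;> simp_all
    refine ⟨.cons huv' .nil, by simp [huv], ?_⟩
    intro e he
    left
    simpa [h] using he

/-- For all positive integers `m, n` with `m + n` even, `m ≠ 2` and `n ≠ 2`, the complete
bipartite graph `K_{m,n}` is path-pairable. -/
theorem statement_15 (m n : ℕ) (hm : 0 < m) (hn : 0 < n) (heven : Even (m + n))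
    (hm2 : m ≠ 2) (hn2 : n ≠ 2) :
    IsPathPairable (completeBipartiteGraph (Fin m) (Fin n)) := by
  refine ⟨by simpa using heven, fun f hf hne => ?_⟩
  have : NeZero m := ⟨hm.ne'⟩
  have : NeZero n := ⟨hn.ne'⟩
  obtain ⟨mid, hmid, hdisj⟩ := exists_midpoints (by simpa using hm2) (by simpa using hn2) f hf hne
  choose P hP hedge using fun v => exists_walk_through_midpoint (hne v).symm (hmid v)
  refine ⟨P, hP, fun u v huv hufv e heu hev => ?_⟩
  have := hdisj u v
  have := hdisj v u
  have := hmid u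
  have := hmid v
  have := hf u
  have := hf v
  obtain ⟨hu, rfl⟩ | ⟨hu, rfl | rfl⟩ := hedge u e heu <;>
  obtain ⟨hv, h⟩ | ⟨hv, h | h⟩ := hedge v _ hev <;>
  clear hdisj hedge hmid hP heu hev heven <;>
  obtain ⟨h₁, h₂⟩ | ⟨h₁, h₂⟩ := Sym2.eq_iff.mp h <;>
  clear h <;>
  grind
end
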